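/- Let B and R be disjoint finite sets of points in the plane whose union is in strong general position. If |B| ≥ 5, then B is separable from R, and moreover a separating simple polygon with at most 2|B| − 2 vertices exists. -/

import Mathlib

open scoped RealInnerProductSpace ENNReal Classical

noncomputable section

/-- Points of the Euclidean plane. -/
abbrev Pt : Type := EuclideanSpace ℝ (Fin 2)

/-- The planar determinant `det (u, v)` of two vectors. -/
def det2 (u v : Pt) : ℝ := u 0 * v 1 - u 1 * v 0

/-- No three of the points of `S` are collinear. -/
def NoThreeCollinear (S : Set Pt) : Prop :=
  ∀ p ∈ S, ∀ q ∈ S, ∀ r ∈ S, p ≠ q → p ≠ r → q ≠ r → det2 (q - p) (r - p) ≠ 0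

/-- `S` is in strong general position: no three points are collinear and for any four
distinct points `p₁ p₂ p₃ p₄` the line through `p₁,p₂` is not parallel to the line
through `p₃,p₄`. -/
def StrongGenPos (S : Set Pt) : Prop :=
  NoThreeCollinear S ∧
    ∀ p₁ ∈ S, ∀ p₂ ∈ S, ∀ p₃ ∈ S, ∀ p₄ ∈ S,
      p₁ ≠ p₂ → p₁ ≠ p₃ → p₁ ≠ p₄ → p₂ ≠ p₃ → p₂ ≠ p₄ → p₃ ≠ p₄ →
        det2 (p₂ - p₁) (p₄ - p₃) ≠ 0

/-- A simple polygon, given by a cyclic sequence of `n ≥ 3` distinct vertices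
(encoded as an `n`-periodic function `ℕ → Pt`), such that no point of the plane lies on
more than two closed edges, and the only points lying on exactly two edges are vertices. -/
structure SimplePolygon where
  n : ℕ
  three_le : 3 ≤ n
  vtx : ℕ → Pt
  periodic : ∀ i, vtx (i + n) = vtx i
  inj : ∀ i < n, ∀ j < n, vtx i = vtx j → i = j
  simple : ∀ x : Pt, {i | i < n ∧ x ∈ segment ℝ (vtx i) (vtx (i + 1))}.ncard ≤ 2
  vtx_of_two : ∀ x : Pt,
    {i | i < n ∧ x ∈ segment ℝ (vtx i) (vtx (i + 1))}.ncard = 2 → ∃ i < n, x = vtx i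

namespace SimplePolygon

/-- The boundary of a simple polygon: the union of its closed edges. -/
def boundary (P : SimplePolygon) : Set Pt :=
  ⋃ i ∈ Finset.range P.n, segment ℝ (P.vtx i) (P.vtx (i + 1))

/-- The interior of a simple polygon: the union of the bounded connected components of the
complement of the boundary. -/
def interior (P : SimplePolygon) : Set Pt :=
  {x | x ∉ P.boundary ∧ Bornology.IsBounded (connectedComponentIn P.boundaryᶜ x)}

/-- A simple polygon, regarded as a point set: boundary together with interior. -/
def region (P : SimplePolygon) : Set Pt := P.boundary ∪ P.interior

/-- The set of vertices of the polygon. -/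
def vertexSet (P : SimplePolygon) : Set Pt := {x | ∃ i < P.n, x = P.vtx i}

/-- Twice the shoelace signed area. -/
def shoelace (P : SimplePolygon) : ℝ := ∑ i ∈ Finset.range P.n, det2 (P.vtx i) (P.vtx (i + 1))

/-- The vertices are listed in counterclockwise order (positive shoelace signed area). -/
def CCW (P : SimplePolygon) : Prop := 0 < P.shoelace

/-- The vertex `vtx (i+1)` is a convex vertex:
`det (v_{i+1} − v_i, v_{i+2} − v_{i+1}) > 0` (vertices listed counterclockwise). -/
def ConvexAt (P : SimplePolygon) (i : ℕ) : Prop :=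
  0 < det2 (P.vtx (i + 1) - P.vtx i) (P.vtx (i + 2) - P.vtx (i + 1))

/-- The number of convex vertices of the polygon. -/
def numConvex (P : SimplePolygon) : ℕ := {i | i < P.n ∧ P.ConvexAt i}.ncard

/-- Continuous paths from `s` to `t` staying inside the polygon. -/
def pathsIn (P : SimplePolygon) (s t : Pt) : Set (ℝ → Pt) :=
  {γ | ContinuousOn γ (Set.Icc 0 1) ∧ γ 0 = s ∧ γ 1 = t ∧ γ '' Set.Icc (0 : ℝ) 1 ⊆ P.region}

/-- The geodesic distance between `s` and `t` inside the polygon: the infimum of the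
lengths (total variations) of continuous paths in the polygon from `s` to `t`. -/
def geodDist (P : SimplePolygon) (s t : Pt) : ℝ≥0∞ :=
  ⨅ γ ∈ P.pathsIn s t, eVariationOn γ (Set.Icc 0 1)

end SimplePolygon

/-- Length of a polygonal path through a list of points. -/
def polylineLen : List Pt → ℝ
  | [] => 0
  | [_] => 0
  | a :: b :: l => dist a b + polylineLen (b :: l)

/-- The polygonal path through a list of points, as a point set. -/
def polylineSet : List Pt → Set Pt
  | [] => ∅
  | [a] => {a}
  | a :: b :: l => segment ℝ a b ∪ polylineSet (b :: l)

/-- `L` is the vertex sequence of the geodesic from `s` to `t` inside the polygon `P`: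
a polygonal path inside `P` from `s` to `t`, with consecutive vertices distinct, with no
three consecutive vertices collinear, whose length realizes the geodesic distance. -/
def SimplePolygon.IsGeodesicChain (P : SimplePolygon) (s t : Pt) (L : List Pt) : Prop :=
  L.head? = some s ∧ L.getLast? = some t ∧ List.Chain' (· ≠ ·) L ∧
  (∀ i, i + 2 < L.length →
      det2 (L.getD (i + 1) 0 - L.getD i 0) (L.getD (i + 2) 0 - L.getD i 0) ≠ 0) ∧
  polylineSet L ⊆ P.region ∧
  ENNReal.ofReal (polylineLen L) = P.geodDist s t

/-- The triple `(p,q,r)` is in geodesic counterclockwise order with respect to `P`: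
writing the geodesics `π(p,q) = ⟨p = v₀, …, v_k = q⟩` and `π(p,r) = ⟨p = u₀, …, u_{k'} = r⟩`
and taking the smallest index `i > 0` with `v_i ≠ u_i`, we have
`det (v_i − v_{i−1}, u_i − v_{i−1}) > 0`. -/
def geodesicCCW (P : SimplePolygon) (p q r : Pt) : Prop :=
  ∃ L M : List Pt, P.IsGeodesicChain p q L ∧ P.IsGeodesicChain p r M ∧
    ∃ i : ℕ, 0 < i ∧ (∀ j < i, L[j]? = M[j]?) ∧ L[i]? ≠ M[i]? ∧
      ∃ a b c : Pt, L[i - 1]? = some a ∧ L[i]? = some b ∧ M[i]? = some c ∧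
        0 < det2 (b - a) (c - a)

/-- The triple `(p,q,r)` is in geodesic clockwise order with respect to `P`. -/
def geodesicCW (P : SimplePolygon) (p q r : Pt) : Prop :=
  ∃ L M : List Pt, P.IsGeodesicChain p q L ∧ P.IsGeodesicChain p r M ∧
    ∃ i : ℕ, 0 < i ∧ (∀ j < i, L[j]? = M[j]?) ∧ L[i]? ≠ M[i]? ∧
      ∃ a b c : Pt, L[i - 1]? = some a ∧ L[i]? = some b ∧ M[i]? = some c ∧
        det2 (b - a) (c - a) < 0

/-- `C ⊆ P` is geodesically convex: for all `p, q ∈ C` the geodesic connecting them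
stays inside `C`. -/
def GeodesicallyConvex (P : SimplePolygon) (C : Set Pt) : Prop :=
  C ⊆ P.region ∧ ∀ p ∈ C, ∀ q ∈ C, ∀ L, P.IsGeodesicChain p q L → polylineSet L ⊆ C

/-- The geodesic hull `CH_P(U)`: the intersection of all geodesically convex subsets of `P`
containing `U`. -/
def geodesicHull (P : SimplePolygon) (U : Set Pt) : Set Pt :=
  ⋂₀ {C | GeodesicallyConvex P C ∧ U ⊆ C}

/-- `E_P(S)`: the set of points of `S` lying on the (topological) boundary of the geodesic
hull of `S` with respect to `P`. -/
def extremeSet (P : SimplePolygon) (S : Set Pt) : Set Pt :=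
  {x ∈ S | x ∈ frontier (geodesicHull P S)}

/-- `B` is separable from `R`: there is a simple polygon with at most `|B|` convex vertices
whose interior contains all points of `R` and which contains no point of `B`. -/
def Separable (B R : Finset Pt) : Prop :=
  ∃ P : SimplePolygon, P.CCW ∧ P.numConvex ≤ B.card ∧
    (∀ r ∈ R, r ∈ P.interior) ∧ ∀ b ∈ B, b ∉ P.region

/-- Twice the signed area of the triangle `a b c`. -/
def orient (a b c : Pt) : ℝ := det2 (b - a) (c - a)

lemma orient_def (a b c : Pt) :
    orient a b c = (b 0 - a 0) * (c 1 - a 1) - (b 1 - a 1) * (c 0 - a 0) := by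
  simp [orient, det2]

lemma exists_first_of_halfplane (b : Pt) (l₀ l₁ : ℝ)
    (S : Finset Pt) (hS : S.Nonempty)
    (hpos : ∀ s ∈ S, 0 < l₀ * (s 0 - b 0) + l₁ * (s 1 - b 1))
    (hne : ∀ s ∈ S, ∀ t ∈ S, s ≠ t → orient b s t ≠ 0) :
    ∃ c ∈ S, ∀ s ∈ S, s ≠ c → 0 < orient b c s := by
  induction hS using Finset.Nonempty.cons_induction with
  | singleton a => exact ⟨a, by simp, by simp⟩
  | cons a S ha hS ih =>
    obtain ⟨c, hc, hcS⟩ := ih (fun s hs => hpos s (by simp [hs]))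
      (fun s hs t ht => hne s (by simp [hs]) t (by simp [ht]))
    have hac : a ≠ c := fun h => ha (h ▸ hc)
    have h0 := hne a (by simp) c (by simp [hc]) hac
    rcases lt_or_gt_of_ne h0 with h | h
    · refine ⟨c, by simp [hc], fun s hs hsc => ?_⟩
      rcases Finset.mem_cons.1 hs with rfl | hs
      · rw [orient_def] at h ⊢; linarith
      · exact hcS s hs hsc
    · refine ⟨a, by simp, fun s hs hsa => ?_⟩
      rcases Finset.mem_cons.1 hs with rfl | hs
      · exact absurd rfl hsa
      by_cases hsc : s = c
      · rwa [hsc]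
      have h1 := hcS s hs hsc
      have pa := hpos a (by simp)
      have pc := hpos c (by simp [hc])
      have ps := hpos s (by simp [hs])
      rw [orient_def] at h h1 ⊢
      have e1 := mul_pos ps h
      have e2 := mul_pos pa h1
      refine pos_of_mul_pos_right (b := _) ?_ pc.le
      linear_combination e1 + e2

lemma exists_hull_edge (B : Finset Pt) (hcard : 2 ≤ B.card)
    (hgp : NoThreeCollinear (B : Set Pt)) :
    ∃ b ∈ B, ∃ c ∈ B, b ≠ c ∧ ∀ s ∈ B, s ≠ b → s ≠ c → 0 < orient b c s := by
  have hB : B.Nonempty := Finset.card_pos.1 (by omega)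
  obtain ⟨b, hb, hmax⟩ := B.exists_max_image (fun p => p 0 ^ 2 + p 1 ^ 2) hB
  obtain ⟨c, hc, hcs⟩ := exists_first_of_halfplane b (-b 0) (-b 1) (B.erase b)
    (Finset.card_pos.1 (by rw [Finset.card_erase_of_mem hb]; omega))
    (fun s hs => by
      have h1 := hmax s (Finset.mem_of_mem_erase hs)
      have h2 : s ≠ b := Finset.ne_of_mem_erase hs
      have h3 : 0 < (s 0 - b 0) ^ 2 + (s 1 - b 1) ^ 2 := by
        by_contra! h
        apply h2
        have e0 : (s 0 - b 0) ^ 2 = 0 := by nlinarith [sq_nonneg (s 0 - b 0), sq_nonneg (s 1 - b 1)]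
        have e1 : (s 1 - b 1) ^ 2 = 0 := by nlinarith [sq_nonneg (s 0 - b 0), sq_nonneg (s 1 - b 1)]
        ext i
        fin_cases i
        · exact sub_eq_zero.1 (pow_eq_zero_iff (two_ne_zero) |>.1 e0)
        · exact sub_eq_zero.1 (pow_eq_zero_iff (two_ne_zero) |>.1 e1)
      simp only at h1
      nlinarith)
    (fun s hs t ht hst => hgp b hb s (Finset.mem_of_mem_erase hs) t (Finset.mem_of_mem_erase ht)
      (Finset.ne_of_mem_erase hs).symm (Finset.ne_of_mem_erase ht).symm hst)
  exact ⟨b, hb, c, Finset.mem_of_mem_erase hc, (Finset.ne_of_mem_erase hc).symm,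
    fun s hs hsb hsc => hcs s (Finset.mem_erase.2 ⟨hsb, hs⟩) hsc⟩

/-- Among at least five points there are a hull edge `b c` and two further points `p`, `q`
whose line does not meet the segment `b c`. -/
lemma exists_hull_edge_and_line (B : Finset Pt) (hcard : 5 ≤ B.card)
    (hgp : NoThreeCollinear (B : Set Pt)) :
    ∃ b ∈ B, ∃ c ∈ B, ∃ p ∈ B, ∃ q ∈ B, b ≠ c ∧ p ≠ q ∧ p ≠ b ∧ p ≠ c ∧ q ≠ b ∧ q ≠ c ∧
      (∀ s ∈ B, s ≠ b → s ≠ c → 0 < orient b c s) ∧ 0 < orient p q b * orient p q c := by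
  obtain ⟨b, hb, c, hc, hbc, hside⟩ := exists_hull_edge B (by omega) hgp
  have hne : ∀ p ∈ B, ∀ q ∈ B, ∀ r ∈ B, p ≠ q → p ≠ r → q ≠ r → orient p q r ≠ 0 := hgp
  have hcard' : 3 ≤ ((B.erase b).erase c).card := by
    rw [Finset.card_erase_of_mem (Finset.mem_erase.2 ⟨hbc.symm, hc⟩), Finset.card_erase_of_mem hb]
    omega
  obtain ⟨r, hr, hmax⟩ := ((B.erase b).erase c).exists_max_image (fun p => orient b c p)
    (Finset.card_pos.1 (by omega))
  simp only [Finset.mem_erase] at hr hmax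
  obtain ⟨hrc, hrb, hrB⟩ := hr
  by_cases hex : ∃ p ∈ B, p ≠ b ∧ p ≠ c ∧ p ≠ r ∧ 0 < orient r p b * orient r p c
  · obtain ⟨p, hp, hpb, hpc, hpr, h⟩ := hex
    exact ⟨b, hb, c, hc, r, hrB, p, hp, hbc, hpr.symm, hrb, hrc, hpb, hpc, hside, h⟩
  push Not at hex
  have key : ∀ p ∈ B, p ≠ b → p ≠ c → p ≠ r → 0 < orient c r p ∧ 0 < orient r b p := by
    intro p hp hpb hpc hpr
    have h1 := hex p hp hpb hpc hpr
    have h2 := hmax p ⟨hpc, hpb, hp⟩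
    have h3 := hside p hp hpb hpc
    have n1 := hne c hc r hrB p hp hrc.symm hpc.symm hpr.symm
    have n2 := hne r hrB b hb p hp hrb hpr.symm hpb.symm
    have e1 : orient r p b = - orient r b p := by simp only [orient_def]; ring
    have e2 : orient r p c = orient c r p := by simp only [orient_def]; ring
    have e3 : orient b c r = orient b c p + orient c r p + orient r b p := by
      simp only [orient_def]; ring
    rw [e1, e2] at h1
    have h4 : 0 ≤ orient c r p + orient r b p := by linarith
    have h5 : 0 ≤ orient r b p * orient c r p := by linarith
    rcases lt_or_gt_of_ne n1 with h | h
    · rcases lt_or_gt_of_ne n2 with h' | h'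
      · linarith
      · nlinarith [mul_pos_of_neg_of_neg h (neg_neg_of_pos h')]
    · rcases lt_or_gt_of_ne n2 with h' | h'
      · nlinarith [mul_pos h (neg_pos.2 h')]
      · exact ⟨h, h'⟩
  have hcard'' : 1 < (((B.erase b).erase c).erase r).card := by
    rw [Finset.card_erase_of_mem (by simp [*])]
    omega
  obtain ⟨p, hp, q, hq, hpq⟩ := Finset.one_lt_card.1 hcard''
  simp only [Finset.mem_erase] at hp hq
  obtain ⟨hpr, hpc, hpb, hp⟩ := hp
  obtain ⟨hqr, hqc, hqb, hq⟩ := hq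
  have hbcr := hside r hrB hrb hrc
  have nb := hne p hp q hq b hb hpq hpb hqb
  have nc := hne p hp q hq c hc hpq hpc hqc
  have nr := hne p hp q hq r hrB hpq hpr hqr
  have hsigns : 0 < orient p q b * orient p q c ∨ 0 < orient p q c * orient p q r ∨
      0 < orient p q r * orient p q b := by
    rcases lt_or_gt_of_ne nb with h1 | h1 <;> rcases lt_or_gt_of_ne nc with h2 | h2 <;>
      rcases lt_or_gt_of_ne nr with h3 | h3 <;>
      simp only [mul_pos_iff, h1, h2, h3, true_and, true_or, or_true]
  rcases hsigns with h | h | h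
  · exact ⟨b, hb, c, hc, p, hp, q, hq, hbc, hpq, hpb, hpc, hqb, hqc, hside, h⟩
  · refine ⟨c, hc, r, hrB, p, hp, q, hq, hrc.symm, hpq, hpc, hpr, hqc, hqr,
      fun s hs hsc hsr => ?_, h⟩
    by_cases hsb : s = b
    · have : orient c r b = orient b c r := by simp only [orient_def]; ring
      rw [hsb, this]; exact hbcr
    · exact (key s hs hsb hsc hsr).1
  · refine ⟨r, hrB, b, hb, p, hp, q, hq, hrb, hpq, hpr, hpb, hqr, hqb,
      fun s hs hsr hsb => ?_, h⟩
    by_cases hsc : s = c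
    · have : orient r b c = orient b c r := by simp only [orient_def]; ring
      rw [hsc, this]; exact hbcr
    · exact (key s hs hsb hsc hsr).2

lemma mem_segment_map_iff (e : Pt ≃ᵃ[ℝ] Pt) (x a b : Pt) :
    x ∈ segment ℝ (e a) (e b) ↔ e.symm x ∈ segment ℝ a b := by
  have h : e '' segment ℝ a b = segment ℝ (e a) (e b) := image_segment ℝ e.toAffineMap a b
  rw [← h]
  constructor
  · rintro ⟨y, hy, rfl⟩; simpa using hy
  · intro hy; exact ⟨_, hy, by simp⟩

namespace SimplePolygon

/-- The image of a simple polygon under an affine bijection of the plane. -/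
def map (P : SimplePolygon) (e : Pt ≃ᵃ[ℝ] Pt) : SimplePolygon where
  n := P.n
  three_le := P.three_le
  vtx i := e (P.vtx i)
  periodic i := by rw [P.periodic]
  inj i hi j hj h := P.inj i hi j hj (e.injective h)
  simple x := by simpa only [mem_segment_map_iff] using P.simple (e.symm x)
  vtx_of_two x hx := by
    simp only [mem_segment_map_iff] at hx
    obtain ⟨i, hi, h⟩ := P.vtx_of_two _ hx
    exact ⟨i, hi, by rw [← h]; simp⟩

lemma vtx_modEq (P : SimplePolygon) {i j : ℕ} (h : i ≡ j [MOD P.n]) : P.vtx i = P.vtx j := by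
  have key : ∀ i, P.vtx i = P.vtx (i % P.n) := fun i =>
    (Function.Periodic.map_mod_nat (f := P.vtx) P.periodic i).symm
  rw [key i, key j, h]

/-- The vertex at position `i` of the reversed polygon. -/
def revVtx (P : SimplePolygon) (i : ℕ) : Pt := P.vtx (P.n - 1 - i % P.n)

lemma revVtx_eq (P : SimplePolygon) {i j : ℕ} (h : P.n ∣ i + j + 1) : P.revVtx i = P.vtx j := by
  have hn := P.three_le
  apply P.vtx_modEq
  have h1 : i % P.n < P.n := Nat.mod_lt _ (by omega)
  have h2 : (P.n - 1 - i % P.n) + (i % P.n + 1) ≡ j + (i % P.n + 1) [MOD P.n] := by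
    have e1 : (P.n - 1 - i % P.n) + (i % P.n + 1) = P.n := by omega
    rw [e1]
    have e2 : j + (i % P.n + 1) ≡ j + (i + 1) [MOD P.n] :=
      Nat.ModEq.add_left _ (Nat.ModEq.add_right _ (Nat.mod_modEq _ _))
    refine Nat.ModEq.trans ?_ e2.symm
    have e3 : j + (i + 1) = i + j + 1 := by ring
    rw [e3]
    exact ((Nat.modEq_zero_iff_dvd.2 (dvd_refl _)).trans (Nat.modEq_zero_iff_dvd.2 h).symm)
  exact Nat.ModEq.add_right_cancel' _ h2

/-- The involution of `{0, …, n - 1}` sending `i` to `n - 1 - c - i` modulo `n`. -/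
def flip (n c i : ℕ) : ℕ := if i + c < n then n - 1 - c - i else 2 * n - 1 - c - i

lemma flip_lt {n c i : ℕ} (hc : c < n) (hi : i < n) : flip n c i < n := by
  unfold flip; split_ifs <;> omega

lemma flip_flip {n c i : ℕ} (hc : c < n) (hi : i < n) : flip n c (flip n c i) = i := by
  unfold flip; split_ifs <;> omega

lemma dvd_flip {n c i : ℕ} (hc : c < n) (hi : i < n) : n ∣ i + flip n c i + c + 1 := by
  unfold flip; split_ifs
  · exact ⟨1, by omega⟩
  · exact ⟨2, by omega⟩

lemma ncard_flip {n c : ℕ} (hc : c < n) (p : ℕ → Prop) :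
    {i | i < n ∧ p (flip n c i)}.ncard = {i | i < n ∧ p i}.ncard := by
  refine Set.ncard_congr (fun i _ => flip n c i) ?_ ?_ ?_
  · rintro i ⟨hi, h⟩; exact ⟨flip_lt hc hi, h⟩
  · rintro i j ⟨hi, -⟩ ⟨hj, -⟩ h
    rw [← flip_flip hc hi, ← flip_flip hc hj, h]
  · rintro i ⟨hi, h⟩
    exact ⟨flip n c i, ⟨flip_lt hc hi, by rwa [flip_flip hc hi]⟩, flip_flip hc hi⟩

lemma revVtx_flip (P : SimplePolygon) {i : ℕ} (hi : i < P.n) :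
    P.revVtx i = P.vtx (flip P.n 1 i + 1) ∧ P.revVtx (i + 1) = P.vtx (flip P.n 1 i) := by
  have hn := P.three_le
  have h := dvd_flip (n := P.n) (c := 1) (by omega) hi
  exact ⟨P.revVtx_eq (by convert h using 1; ring), P.revVtx_eq (by convert h using 1; ring)⟩

lemma ncard_revVtx (P : SimplePolygon) (x : Pt) :
    {i | i < P.n ∧ x ∈ segment ℝ (P.revVtx i) (P.revVtx (i + 1))}.ncard =
      {i | i < P.n ∧ x ∈ segment ℝ (P.vtx i) (P.vtx (i + 1))}.ncard := by
  have hn := P.three_le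
  rw [← ncard_flip (c := 1) (by omega) fun i => x ∈ segment ℝ (P.vtx i) (P.vtx (i + 1))]
  congr 1
  ext i
  refine and_congr_right fun hi => ?_
  obtain ⟨h1, h2⟩ := P.revVtx_flip hi
  rw [h1, h2, segment_symm]

/-- The polygon with its vertices listed in the opposite order. -/
def reverse (P : SimplePolygon) : SimplePolygon where
  n := P.n
  three_le := P.three_le
  vtx := P.revVtx
  periodic i := by simp [revVtx]
  inj i hi j hj h := by
    have h' := P.inj _ (by omega) _ (by omega) h
    rw [Nat.mod_eq_of_lt hi, Nat.mod_eq_of_lt hj] at h'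
    omega
  simple x := by rw [ncard_revVtx]; exact P.simple x
  vtx_of_two x hx := by
    have hn := P.three_le
    rw [ncard_revVtx] at hx
    obtain ⟨i, hi, rfl⟩ := P.vtx_of_two x hx
    exact ⟨P.n - 1 - i, by omega, (P.revVtx_eq ⟨1, by omega⟩).symm⟩

lemma mem_boundary {P : SimplePolygon} {x : Pt} :
    x ∈ P.boundary ↔ ∃ i < P.n, x ∈ segment ℝ (P.vtx i) (P.vtx (i + 1)) := by
  simp [boundary]

lemma boundary_reverse (P : SimplePolygon) : P.reverse.boundary = P.boundary := by
  have hn := P.three_le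
  ext x
  rw [mem_boundary, mem_boundary]
  constructor
  · rintro ⟨i, hi, h⟩
    obtain ⟨h1, h2⟩ := P.revVtx_flip hi
    refine ⟨flip P.n 1 i, flip_lt (by omega) hi, ?_⟩
    rw [segment_symm, ← h1, ← h2]; exact h
  · rintro ⟨i, hi, h⟩
    obtain ⟨h1, h2⟩ := P.revVtx_flip (flip_lt (c := 1) (by omega) hi)
    rw [flip_flip (by omega) hi] at h1 h2
    refine ⟨flip P.n 1 i, flip_lt (by omega) hi, ?_⟩
    change x ∈ segment ℝ (P.revVtx _) (P.revVtx _)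
    rwa [h1, h2, segment_symm]

lemma interior_reverse (P : SimplePolygon) : P.reverse.interior = P.interior := by
  simp only [interior, boundary_reverse]

lemma shoelace_reverse (P : SimplePolygon) : P.reverse.shoelace = -P.shoelace := by
  have hn := P.three_le
  unfold shoelace
  rw [← Finset.sum_neg_distrib]
  refine Finset.sum_nbij' (flip P.n 1) (flip P.n 1) ?_ ?_ ?_ ?_ ?_
  · intro i hi; exact Finset.mem_range.2 (flip_lt (by omega) (Finset.mem_range.1 hi))
  · intro i hi; exact Finset.mem_range.2 (flip_lt (by omega) (Finset.mem_range.1 hi))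
  · intro i hi; exact flip_flip (by omega) (Finset.mem_range.1 hi)
  · intro i hi; exact flip_flip (by omega) (Finset.mem_range.1 hi)
  · intro i hi
    obtain ⟨h1, h2⟩ := P.revVtx_flip (Finset.mem_range.1 hi)
    change det2 (P.revVtx i) (P.revVtx (i + 1)) = _
    rw [h1, h2]
    simp only [det2]; ring

lemma numConvex_reverse (P : SimplePolygon) : P.reverse.numConvex =
    {i | i < P.n ∧
      det2 (P.vtx (i + 1) - P.vtx i) (P.vtx (i + 2) - P.vtx (i + 1)) < 0}.ncard := by
  have hn := P.three_le
  rw [numConvex, ← ncard_flip (n := P.n) (c := 2) (by omega) fun i =>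
    det2 (P.vtx (i + 1) - P.vtx i) (P.vtx (i + 2) - P.vtx (i + 1)) < 0]
  congr 1
  ext i
  refine and_congr_right fun hi => ?_
  have h := dvd_flip (n := P.n) (c := 2) (by omega) hi
  change 0 < det2 (P.revVtx (i + 1) - P.revVtx i) (P.revVtx (i + 2) - P.revVtx (i + 1)) ↔ _
  rw [P.revVtx_eq (i := i) (j := flip P.n 2 i + 2) (by convert h using 1; ring),
    P.revVtx_eq (i := i + 1) (j := flip P.n 2 i + 1) (by convert h using 1; ring),
    P.revVtx_eq (i := i + 2) (j := flip P.n 2 i) (by convert h using 1; ring)]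
  rw [← neg_pos]
  simp only [det2, PiLp.sub_apply]
  ring_nf

lemma boundary_map (P : SimplePolygon) (e : Pt ≃ᵃ[ℝ] Pt) :
    (P.map e).boundary = e '' P.boundary := by
  ext x
  rw [mem_boundary]
  constructor
  · rintro ⟨i, hi, h⟩
    exact ⟨e.symm x, mem_boundary.2 ⟨i, hi, (mem_segment_map_iff e _ _ _).1 h⟩, by simp⟩
  · rintro ⟨y, hy, rfl⟩
    obtain ⟨i, hi, h⟩ := mem_boundary.1 hy
    exact ⟨i, hi, (mem_segment_map_iff e _ _ _).2 (by simpa using h)⟩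

lemma mem_interior_map (P : SimplePolygon) (e : Pt ≃ᵃ[ℝ] Pt) (x : Pt) :
    e x ∈ (P.map e).interior ↔ x ∈ P.interior := by
  have hb : ∀ (f : Pt ≃ᵃ[ℝ] Pt) (s : Set Pt),
      Bornology.IsBounded s → Bornology.IsBounded (f '' s) := fun f s hs =>
    (hs.isCompact_closure.image f.toAffineMap.continuous_of_finiteDimensional).isBounded.subset
      (Set.image_mono subset_closure)
  unfold interior
  simp only [Set.mem_ofPred_eq, boundary_map]
  refine and_congr (not_congr (e.injective.mem_set_image)) ?_
  by_cases hx : x ∈ P.boundaryᶜ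
  · have h : e '' _ = _ :=
      (AffineEquiv.toContinuousAffineEquiv e).toHomeomorph.image_connectedComponentIn hx
    change e '' _ = connectedComponentIn (e '' P.boundaryᶜ) (e x) at h
    rw [← Set.image_compl_eq e.bijective, ← h]
    constructor
    · intro h'
      have := hb e.symm _ h'
      rwa [← Set.image_comp, show (⇑e.symm ∘ ⇑e) = id by ext1; simp, Set.image_id] at this
    · exact hb e _
  · have hx' : e x ∉ (e '' P.boundary)ᶜ := by
      simpa using hx
    rw [connectedComponentIn_eq_empty hx, connectedComponentIn_eq_empty hx']

lemma shoelace_map (P : SimplePolygon) (e : Pt ≃ᵃ[ℝ] Pt) (κ : ℝ)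
    (he : ∀ u v, det2 (e.linear u) (e.linear v) = κ * det2 u v) :
    (P.map e).shoelace = κ * P.shoelace := by
  have hv : ∀ p, e p = e.linear p + e 0 := fun p => by
    have := e.map_vadd 0 p
    simpa using this
  have hd : ∀ i, det2 ((P.map e).vtx i) ((P.map e).vtx (i + 1)) =
      κ * det2 (P.vtx i) (P.vtx (i + 1)) +
        (det2 (e 0) (e.linear (P.vtx (i + 1))) - det2 (e 0) (e.linear (P.vtx i))) := fun i => by
    rw [← he]
    change det2 (e (P.vtx i)) (e (P.vtx (i + 1))) = _
    rw [hv, hv (P.vtx (i + 1))]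
    simp only [det2, PiLp.add_apply]; ring
  change ∑ i ∈ Finset.range P.n, _ = _
  rw [Finset.sum_congr rfl fun i _ => hd i, Finset.sum_add_distrib, ← Finset.mul_sum,
    Finset.sum_range_sub (fun i => det2 (e 0) (e.linear (P.vtx i)))]
  have h0 : P.vtx P.n = P.vtx 0 := by simpa using P.periodic 0
  simp [h0, shoelace]

lemma det2_map (P : SimplePolygon) (e : Pt ≃ᵃ[ℝ] Pt) (κ : ℝ)
    (he : ∀ u v, det2 (e.linear u) (e.linear v) = κ * det2 u v) (i j k : ℕ) :
    det2 ((P.map e).vtx j - (P.map e).vtx i) ((P.map e).vtx k - (P.map e).vtx j) =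
      κ * det2 (P.vtx j - P.vtx i) (P.vtx k - P.vtx j) := by
  rw [← he]
  have hs : ∀ p q, e p - e q = e.linear (p - q) := fun p q =>
    (e.toAffineMap.linearMap_vsub p q).symm
  change det2 (e _ - e _) (e _ - e _) = _
  rw [hs, hs]

end SimplePolygon

/-- Some simple polygon with at most `m` convex and at most `2 * m - 2` vertices in total
contains `R` in its interior and misses `B`. -/
def SeparableWithin (m : ℕ) (B R : Set Pt) : Prop :=
  ∃ P : SimplePolygon, P.CCW ∧ P.numConvex ≤ m ∧ P.n ≤ 2 * m - 2 ∧
    (∀ r ∈ R, r ∈ P.interior) ∧ ∀ b ∈ B, b ∉ P.region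

lemma SeparableWithin.of_image {m : ℕ} {B R : Set Pt} (e : Pt ≃ᵃ[ℝ] Pt) (κ : ℝ) (hκ : κ ≠ 0)
    (he : ∀ u v, det2 (e.linear u) (e.linear v) = κ * det2 u v)
    (h : SeparableWithin m B R) : SeparableWithin m (e '' B) (e '' R) := by
  obtain ⟨P, hccw, hconv, hn, hR, hB⟩ := h
  have hreg : ∀ b ∈ B, e b ∉ (P.map e).boundary ∪ (P.map e).interior := by
    intro b hb h
    rw [Set.mem_union, P.mem_interior_map, P.boundary_map, e.injective.mem_set_image] at h
    exact hB b hb h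
  have hmem : ∀ r ∈ R, e r ∈ (P.map e).interior := fun r hr =>
    (P.mem_interior_map e r).2 (hR r hr)
  rcases lt_or_gt_of_ne hκ with h0 | h0
  · refine ⟨(P.map e).reverse, ?_, ?_, hn, ?_, ?_⟩
    · unfold SimplePolygon.CCW at hccw ⊢
      rw [SimplePolygon.shoelace_reverse, P.shoelace_map e κ he]
      nlinarith
    · rw [SimplePolygon.numConvex_reverse]
      refine le_of_eq_of_le ?_ hconv
      unfold SimplePolygon.numConvex
      congr 1
      ext i
      refine and_congr_right fun _ => ?_
      rw [P.det2_map e κ he, mul_neg_iff]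
      simp [h0, h0.le, SimplePolygon.ConvexAt]
    · rw [SimplePolygon.interior_reverse]
      rintro _ ⟨r, hr, rfl⟩; exact hmem r hr
    · unfold SimplePolygon.region
      rw [SimplePolygon.interior_reverse, SimplePolygon.boundary_reverse]
      rintro _ ⟨b, hb, rfl⟩; exact hreg b hb
  · refine ⟨P.map e, ?_, ?_, hn, ?_, ?_⟩
    · unfold SimplePolygon.CCW at hccw ⊢
      rw [P.shoelace_map e κ he]
      positivity
    · refine le_of_eq_of_le ?_ hconv
      unfold SimplePolygon.numConvex
      congr 1
      ext i
      refine and_congr_right fun _ => ?_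
      unfold SimplePolygon.ConvexAt
      rw [P.det2_map e κ he, mul_pos_iff_of_pos_left h0]
    · rintro _ ⟨r, hr, rfl⟩; exact hmem r hr
    · rintro _ ⟨b, hb, rfl⟩; exact hreg b hb

lemma mem_segment_iff_coord {p a b : Pt} :
    p ∈ segment ℝ a b ↔ ∃ t : ℝ, 0 ≤ t ∧ t ≤ 1 ∧
      p 0 = (1 - t) * a 0 + t * b 0 ∧ p 1 = (1 - t) * a 1 + t * b 1 := by
  rw [segment_eq_image]
  constructor
  · rintro ⟨t, ⟨h0, h1⟩, rfl⟩
    exact ⟨t, h0, h1, by simp, by simp⟩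
  · rintro ⟨t, h0, h1, hx, hy⟩
    refine ⟨t, ⟨h0, h1⟩, ?_⟩
    ext i
    fin_cases i
    · simpa using hx.symm
    · simpa using hy.symm

lemma mem_segment_iff_of_lt {p a b : Pt} (hab : a 1 < b 1) :
    p ∈ segment ℝ a b ↔ a 1 ≤ p 1 ∧ p 1 ≤ b 1 ∧
      (p 0 - a 0) * (b 1 - a 1) = (b 0 - a 0) * (p 1 - a 1) := by
  have hd : 0 < b 1 - a 1 := sub_pos.2 hab
  rw [mem_segment_iff_coord]
  constructor
  · rintro ⟨t, h0, h1, hx, hy⟩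
    refine ⟨by nlinarith, by nlinarith, ?_⟩
    rw [hx, hy]; ring
  · rintro ⟨h0, h1, h⟩
    have ht : (p 1 - a 1) / (b 1 - a 1) * (b 1 - a 1) = p 1 - a 1 := div_mul_cancel₀ _ hd.ne'
    refine ⟨(p 1 - a 1) / (b 1 - a 1), div_nonneg (by linarith) hd.le,
      (div_le_one hd).2 (by linarith), ?_, by linear_combination -ht⟩
    have h2 : p 0 - a 0 = (b 0 - a 0) * ((p 1 - a 1) / (b 1 - a 1)) := by
      rw [← mul_div_assoc, eq_div_iff hd.ne', h]
    linear_combination h2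

lemma ext_coord {p q : Pt} (h0 : p 0 = q 0) (h1 : p 1 = q 1) : p = q := by
  ext i
  fin_cases i
  · exact h0
  · exact h1

/-- If an affine functional is positive at `a`, nonnegative at `b` and zero at a point `p` of the
segment, then `p = b`. -/
lemma eq_of_mem_segment_of_affine {p a b : Pt} (c l₀ l₁ : ℝ) (hp : p ∈ segment ℝ a b)
    (ha : 0 < c + l₀ * a 0 + l₁ * a 1) (hb : 0 ≤ c + l₀ * b 0 + l₁ * b 1)
    (h : c + l₀ * p 0 + l₁ * p 1 ≤ 0) : p = b ∧ c + l₀ * b 0 + l₁ * b 1 = 0 := by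
  obtain ⟨t, h0, h1, hx, hy⟩ := mem_segment_iff_coord.1 hp
  rw [hx, hy] at h
  have e : (1 - t) * (c + l₀ * a 0 + l₁ * a 1) + t * (c + l₀ * b 0 + l₁ * b 1) ≤ 0 := by
    linarith
  have ht : t = 1 := by
    by_contra hne
    have : 0 < 1 - t := by
      rcases lt_or_eq_of_le h1 with h1 | h1
      · linarith
      · exact absurd h1 hne
    have := mul_pos this ha
    have := mul_nonneg h0 hb
    linarith
  subst ht
  exact ⟨ext_coord (by rw [hx]; ring) (by rw [hy]; ring), by linarith⟩

namespace SimplePolygon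

/-- A closed polygonal curve through `n` distinct points `v 0, …, v (n - 1)`, any two of whose
edges meet only if they are consecutive, and then only in the common vertex, is simple. -/
def ofVertices (n : ℕ) (hn : 3 ≤ n) (v : ℕ → Pt) (hclosed : v n = v 0)
    (hinj : ∀ i < n, ∀ j < n, v i = v j → i = j)
    (hmeet : ∀ i j p, i < j → j < n → p ∈ segment ℝ (v i) (v (i + 1)) →
      p ∈ segment ℝ (v j) (v (j + 1)) → (j = i + 1 ∧ p = v j) ∨ (i = 0 ∧ j + 1 = n ∧ p = v 0)) :
    SimplePolygon :=
  have hsucc : ∀ i < n, v ((i + 1) % n) = v (i + 1) := fun i hi => by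
    rcases (Nat.succ_le_of_lt hi).lt_or_eq with h | h
    · rw [Nat.mod_eq_of_lt h]
    · rw [Nat.succ_eq_add_one] at h; rw [h, Nat.mod_self, hclosed]
  have hset : ∀ x, {i | i < n ∧ x ∈ segment ℝ (v (i % n)) (v ((i + 1) % n))} =
      {i | i < n ∧ x ∈ segment ℝ (v i) (v (i + 1))} := fun x => by
    ext i
    refine and_congr_right fun hi => ?_
    rw [hsucc i hi, Nat.mod_eq_of_lt hi]
  { n := n
    three_le := hn
    vtx := fun i => v (i % n)
    periodic := fun i => by simp
    inj := fun i hi j hj h => by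
      rw [Nat.mod_eq_of_lt hi, Nat.mod_eq_of_lt hj] at h
      exact hinj i hi j hj h
    simple := fun x => by
      rw [hset]
      have hfin : {i | i < n ∧ x ∈ segment ℝ (v i) (v (i + 1))}.Finite :=
        (Set.finite_lt_nat n).subset fun i hi => hi.1
      have key : ∀ i j k, i < j → j < k → k < n → x ∈ segment ℝ (v i) (v (i + 1)) →
          x ∈ segment ℝ (v j) (v (j + 1)) → x ∈ segment ℝ (v k) (v (k + 1)) → False := by
        intro i j k hij hjk hk h1 h2 h3
        rcases hmeet i k x (by omega) hk h1 h3 with h | ⟨rfl, hkn, hx⟩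
        · omega
        rcases hmeet 0 j x hij (by omega) h1 h2 with ⟨rfl, h⟩ | h
        · have := hinj 0 (by omega) _ (by omega) (hx.symm.trans h)
          omega
        · omega
      by_contra! hlt
      obtain ⟨a, b, c, ⟨ha, ha'⟩, ⟨hb, hb'⟩, ⟨hc, hc'⟩, hab, hac, hbc⟩ :=
        (Set.two_lt_ncard_iff hfin).1 hlt
      rcases lt_or_gt_of_ne hab with h1 | h1 <;> rcases lt_or_gt_of_ne hac with h2 | h2 <;>
        rcases lt_or_gt_of_ne hbc with h3 | h3
      · exact key a b c h1 h3 hc ha' hb' hc'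
      · exact key a c b h2 h3 hb ha' hc' hb'
      · omega
      · exact key c a b h2 h1 hb hc' ha' hb'
      · exact key b a c h1 h2 hc hb' ha' hc'
      · omega
      · exact key b c a h3 h2 ha hb' hc' ha'
      · exact key c b a h3 h1 ha hc' hb' ha'
    vtx_of_two := fun x hx => by
      rw [hset] at hx
      have key : ∀ i j, i < j → j < n → x ∈ segment ℝ (v i) (v (i + 1)) →
          x ∈ segment ℝ (v j) (v (j + 1)) → ∃ i < n, x = v (i % n) := by
        intro i j hij hj h1 h2
        rcases hmeet i j x hij hj h1 h2 with ⟨-, h⟩ | ⟨-, -, h⟩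
        · exact ⟨j, hj, by rw [Nat.mod_eq_of_lt hj, h]⟩
        · exact ⟨0, by omega, by simpa using h⟩
      obtain ⟨i, j, hij, hs⟩ := Set.ncard_eq_two.1 hx
      have hi : i ∈ {i | i < n ∧ x ∈ segment ℝ (v i) (v (i + 1))} := by rw [hs]; simp
      have hj : j ∈ {i | i < n ∧ x ∈ segment ℝ (v i) (v (i + 1))} := by rw [hs]; simp
      rcases lt_or_gt_of_ne hij with h | h
      · exact key i j h hj.1 hi.2 hj.2
      · exact key j i h hi.1 hj.2 hi.2 }

section ofVertices

variable (n : ℕ) (hn : 3 ≤ n) (v : ℕ → Pt) (hclosed : v n = v 0)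
    (hinj : ∀ i < n, ∀ j < n, v i = v j → i = j)
    (hmeet : ∀ i j p, i < j → j < n → p ∈ segment ℝ (v i) (v (i + 1)) →
      p ∈ segment ℝ (v j) (v (j + 1)) → (j = i + 1 ∧ p = v j) ∨ (i = 0 ∧ j + 1 = n ∧ p = v 0))

lemma vtx_ofVertices {i : ℕ} (hi : i ≤ n) : (ofVertices n hn v hclosed hinj hmeet).vtx i = v i := by
  change v (i % n) = v i
  rcases hi.lt_or_eq with h | h
  · rw [Nat.mod_eq_of_lt h]
  · rw [h, Nat.mod_self, hclosed]

lemma vtx_ofVertices_succ : (ofVertices n hn v hclosed hinj hmeet).vtx (n + 1) = v 1 := by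
  change v ((n + 1) % n) = v 1
  rw [Nat.add_mod_left, Nat.mod_eq_of_lt (by omega)]

lemma mem_boundary_ofVertices {x : Pt} : x ∈ (ofVertices n hn v hclosed hinj hmeet).boundary ↔
    ∃ i < n, x ∈ segment ℝ (v i) (v (i + 1)) := by
  rw [mem_boundary]
  refine exists_congr fun i => and_congr_right fun hi => ?_
  change i < n at hi
  rw [vtx_ofVertices (hi := hi.le), vtx_ofVertices (hi := hi)]

lemma shoelace_ofVertices : (ofVertices n hn v hclosed hinj hmeet).shoelace =
    ∑ i ∈ Finset.range n, det2 (v i) (v (i + 1)) := by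
  refine Finset.sum_congr rfl fun i hi => ?_
  have hi : i < n := Finset.mem_range.1 hi
  rw [vtx_ofVertices (hi := hi.le), vtx_ofVertices (hi := hi)]

end ofVertices

end SimplePolygon

/-- The point of the plane with coordinates `x` and `y`. -/
def mkPt (x y : ℝ) : Pt := !₂[x, y]

@[simp] lemma mkPt_zero (x y : ℝ) : mkPt x y 0 = x := by simp [mkPt]

@[simp] lemma mkPt_one (x y : ℝ) : mkPt x y 1 = y := by simp [mkPt]

/-- An affine functional vanishing at `(a * L, L)` and at `(-(a + β) * L / 2, -L)`. -/
def leftWall (a β L : ℝ) (p : Pt) : ℝ := L * (β - a) + 4 * p 0 - (3 * a + β) * p 1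

/-- An affine functional vanishing at `(β * L, L)` and at `(-(a + β) * L / 2, -L)`. -/
def rightWall (a β L : ℝ) (p : Pt) : ℝ := L * (β - a) - 4 * p 0 + (3 * β + a) * p 1

/-- The positively homogeneous function which, on the ray `x = σ i * y`, `0 ≤ y`, with `i ≤ n`
equals `w i * y`, and which is linear between consecutive such rays. -/
def fanGauge (σ w : ℕ → ℝ) : ℕ → Pt → ℝ
  | 0, p => w 0 * p 1
  | n + 1, p => fanGauge σ w n (mkPt (min (p 0) (σ n * p 1)) (p 1)) +
      (w (n + 1) - w n) / (σ (n + 1) - σ n) * max 0 (p 0 - σ n * p 1)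

lemma continuous_mkPt : Continuous fun q : ℝ × ℝ => mkPt q.1 q.2 := by
  unfold mkPt
  fun_prop

lemma continuous_fanGauge (σ w : ℕ → ℝ) (n : ℕ) : Continuous (fanGauge σ w n) := by
  induction n with
  | zero =>
    change Continuous fun p : Pt => w 0 * p 1
    fun_prop
  | succ n ih =>
    have h : Continuous fun p : Pt => mkPt (min (p 0) (σ n * p 1)) (p 1) :=
      continuous_mkPt.comp (f := fun p : Pt => (min (p 0) (σ n * p 1), p 1)) (by fun_prop)
    refine (ih.comp h).add (Continuous.mul continuous_const ?_)
    fun_prop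

lemma fanGauge_top (σ w : ℕ → ℝ) (n : ℕ) (hσ : ∀ i < n, σ i < σ (i + 1)) (p : Pt)
    (hp : 0 ≤ p 1) (hx : p 0 = σ n * p 1) : fanGauge σ w n p = w n * p 1 := by
  induction n generalizing p with
  | zero => rfl
  | succ n ih =>
    have hlt := hσ n (by omega)
    have h1 : σ n * p 1 ≤ p 0 := by rw [hx]; gcongr
    rw [fanGauge, ih (fun i hi => hσ i (by omega)) _ (by simpa) (by simp [h1]),
      max_eq_right (by linarith), hx, mkPt_one, ← sub_mul, ← mul_assoc,
      div_mul_cancel₀ _ (by linarith)]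
    ring

lemma fan_mono {σ : ℕ → ℝ} {n : ℕ} (hσ : ∀ i < n, σ i < σ (i + 1)) {i j : ℕ} (hij : i ≤ j)
    (hj : j ≤ n) : σ i ≤ σ j := by
  induction j, hij using Nat.le_induction with
  | base => exact le_rfl
  | succ j hij ih => exact (ih (by omega)).trans (hσ j (by omega)).le

lemma fan_strictMono {σ : ℕ → ℝ} {n : ℕ} (hσ : ∀ i < n, σ i < σ (i + 1)) {i j : ℕ} (hij : i < j)
    (hj : j ≤ n) : σ i < σ j :=
  (hσ i (by omega)).trans_le (fan_mono hσ hij hj)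

lemma fanGauge_mul (σ w : ℕ → ℝ) (n : ℕ) (hσ : ∀ i < n, σ i < σ (i + 1)) (p : Pt)
    (hp : 0 ≤ p 1) (i : ℕ) (hi : i < n) (h0 : σ i * p 1 ≤ p 0) (h1 : p 0 ≤ σ (i + 1) * p 1) :
    fanGauge σ w n p * (σ (i + 1) - σ i) =
      w i * (σ (i + 1) * p 1 - p 0) + w (i + 1) * (p 0 - σ i * p 1) := by
  induction n generalizing p with
  | zero => omega
  | succ n ih =>
    have hσ' : ∀ i < n, σ i < σ (i + 1) := fun i hi => hσ i (by omega)
    rw [fanGauge]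
    rcases Nat.lt_succ_iff_lt_or_eq.1 hi with hi | rfl
    · have h2 : p 0 ≤ σ n * p 1 := h1.trans (by gcongr; exact fan_mono hσ' hi le_rfl)
      rw [min_eq_left h2, max_eq_left (by linarith), mul_zero, add_zero,
        ih hσ' _ (by simpa) hi (by simpa) (by simpa)]
      simp
    · have hlt := hσ i (by omega)
      rw [min_eq_right h0, max_eq_right (by linarith), fanGauge_top σ w i hσ' _ (by simpa) (by simp),
        add_mul, mul_right_comm (_ / _), div_mul_cancel₀ _ (by linarith), mkPt_one]
      ring

lemma exists_sector {σ : ℕ → ℝ} {n : ℕ} {x y : ℝ} (hn : 1 ≤ n) (h0 : σ 0 * y ≤ x)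
    (h1 : x ≤ σ n * y) : ∃ i < n, σ i * y ≤ x ∧ x ≤ σ (i + 1) * y := by
  induction n, hn using Nat.le_induction with
  | base => exact ⟨0, by omega, h0, h1⟩
  | succ n hn ih =>
    rcases le_total x (σ n * y) with h | h
    · obtain ⟨i, hi, h⟩ := ih h
      exact ⟨i, by omega, h⟩
    · exact ⟨n, by omega, h, h1⟩

/-- The data of a fan-shaped polygon: a chain of points of height `h i` on the rays
`x = σ i * y`, closed up by two long edges and the ray `x = β * y`. -/
structure Fan where
  N : ℕ
  one_le : 1 ≤ N
  σ : ℕ → ℝ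
  h : ℕ → ℝ
  β : ℝ
  σ_lt : ∀ i < N, σ i < σ (i + 1)
  h_pos : ∀ i ≤ N, 0 < h i
  lt_β : σ N < β
  left_pos : ∀ i < N, 0 < leftWall (σ N) β (h N) (mkPt (σ i * h i) (h i))
  right_pos : ∀ i < N, 0 < rightWall (σ N) β (h N) (mkPt (σ i * h i) (h i))
  area_pos : 0 < ∑ i ∈ Finset.range N, h i * h (i + 1) * (σ i - σ (i + 1)) +
    h N ^ 2 * (β - σ N)

namespace Fan

variable (F : Fan)

/-- The points of the chain. -/
def node (i : ℕ) : Pt := mkPt (F.σ i * F.h i) (F.h i)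

/-- The bottom vertex of the fan polygon. -/
def bottom : Pt := mkPt (-((F.σ F.N + F.β) / 2 * F.h F.N)) (-F.h F.N)

/-- The last vertex of the fan polygon. -/
def top : Pt := mkPt (F.β * F.h F.N) (F.h F.N)

/-- The left boundary functional. -/
def left (p : Pt) : ℝ := leftWall (F.σ F.N) F.β (F.h F.N) p

/-- The right boundary functional. -/
def right (p : Pt) : ℝ := rightWall (F.σ F.N) F.β (F.h F.N) p

/-- The gauge of the chain: it equals `1` on the chain. -/
def gauge (p : Pt) : ℝ := fanGauge F.σ (fun i => (F.h i)⁻¹) F.N p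

/-- The vertices of the fan polygon. -/
def vert (i : ℕ) : Pt :=
  if i = 0 then 0 else if i ≤ F.N + 1 then F.node (i - 1) else
    if i = F.N + 2 then F.bottom else if i = F.N + 3 then F.top else 0

lemma vert_zero : F.vert 0 = 0 := by simp [vert]

lemma vert_succ {i : ℕ} (hi : i ≤ F.N) : F.vert (i + 1) = F.node i := by simp [vert, hi]

lemma vert_bottom : F.vert (F.N + 2) = F.bottom := by simp [vert]

lemma vert_top : F.vert (F.N + 3) = F.top := by simp [vert]

lemma vert_last : F.vert (F.N + 4) = 0 := by simp [vert]

lemma hN_pos : 0 < F.h F.N := F.h_pos _ le_rfl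

lemma node_one_pos {i : ℕ} (hi : i ≤ F.N) : 0 < F.node i 1 := by simpa [node] using F.h_pos i hi

lemma left_eq (p : Pt) : F.left p = F.h F.N * (F.β - F.σ F.N) + 4 * p 0 +
    (-(3 * F.σ F.N + F.β)) * p 1 := by
  simp [left, leftWall]; ring

lemma right_eq (p : Pt) : F.right p = F.h F.N * (F.β - F.σ F.N) + (-4) * p 0 +
    (3 * F.β + F.σ F.N) * p 1 := by
  simp [right, rightWall]; ring

lemma mem_firstEdge {p : Pt} : p ∈ segment ℝ 0 (F.node 0) ↔
    0 ≤ p 1 ∧ p 1 ≤ F.h 0 ∧ p 0 = F.σ 0 * p 1 := by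
  have h := F.h_pos 0 (by omega)
  rw [mem_segment_iff_of_lt (by simpa [node] using h)]
  simp only [node, mkPt_zero, mkPt_one, PiLp.zero_apply, sub_zero]
  refine and_congr_right fun _ => and_congr_right fun _ => ?_
  rw [mul_right_comm, mul_left_inj' h.ne']

lemma mem_lastEdge {p : Pt} : p ∈ segment ℝ F.top 0 ↔
    0 ≤ p 1 ∧ p 1 ≤ F.h F.N ∧ p 0 = F.β * p 1 := by
  have h := F.hN_pos
  rw [segment_symm, mem_segment_iff_of_lt (by simpa [top] using h)]
  simp only [top, mkPt_zero, mkPt_one, PiLp.zero_apply, sub_zero]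
  refine and_congr_right fun _ => and_congr_right fun _ => ?_
  rw [mul_right_comm, mul_left_inj' h.ne']

lemma mem_leftEdge {p : Pt} : p ∈ segment ℝ (F.node F.N) F.bottom ↔
    -F.h F.N ≤ p 1 ∧ p 1 ≤ F.h F.N ∧ F.left p = 0 := by
  have h := F.hN_pos
  rw [segment_symm, mem_segment_iff_of_lt (by simpa [node, bottom] using h)]
  simp only [node, bottom, mkPt_zero, mkPt_one, left_eq]
  refine and_congr_right fun _ => and_congr_right fun _ => ?_
  constructor
  · intro h'
    refine mul_left_cancel₀ h.ne' ?_
    linear_combination 2 * h'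
  · intro h'
    linear_combination F.h F.N / 2 * h'

lemma mem_rightEdge {p : Pt} : p ∈ segment ℝ F.bottom F.top ↔
    -F.h F.N ≤ p 1 ∧ p 1 ≤ F.h F.N ∧ F.right p = 0 := by
  have h := F.hN_pos
  rw [mem_segment_iff_of_lt (by simpa [top, bottom] using h)]
  simp only [top, bottom, mkPt_zero, mkPt_one, right_eq]
  refine and_congr_right fun _ => and_congr_right fun _ => ?_
  constructor
  · intro h'
    refine mul_left_cancel₀ h.ne' ?_
    linear_combination -2 * h'
  · intro h'
    linear_combination -F.h F.N / 2 * h'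

lemma gauge_mul {p : Pt} (hp : 0 ≤ p 1) {i : ℕ} (hi : i < F.N) (h0 : F.σ i * p 1 ≤ p 0)
    (h1 : p 0 ≤ F.σ (i + 1) * p 1) : F.gauge p * (F.σ (i + 1) - F.σ i) =
      (F.h i)⁻¹ * (F.σ (i + 1) * p 1 - p 0) + (F.h (i + 1))⁻¹ * (p 0 - F.σ i * p 1) :=
  fanGauge_mul F.σ (fun i => (F.h i)⁻¹) F.N F.σ_lt p hp i hi h0 h1

lemma mem_chainEdge {p : Pt} {i : ℕ} (hi : i < F.N) :
    p ∈ segment ℝ (F.node i) (F.node (i + 1)) ↔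
      0 < p 1 ∧ F.σ i * p 1 ≤ p 0 ∧ p 0 ≤ F.σ (i + 1) * p 1 ∧ F.gauge p = 1 := by
  have h0 := F.h_pos i hi.le
  have h1 := F.h_pos (i + 1) hi
  have hσ := sub_pos.2 (F.σ_lt i hi)
  rw [mem_segment_iff_coord]
  simp only [node, mkPt_zero, mkPt_one]
  constructor
  · rintro ⟨t, t0, t1, hx, hy⟩
    have e0 : F.σ (i + 1) * p 1 - p 0 = (1 - t) * F.h i * (F.σ (i + 1) - F.σ i) := by
      rw [hx, hy]; ring
    have e1 : p 0 - F.σ i * p 1 = t * F.h (i + 1) * (F.σ (i + 1) - F.σ i) := by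
      rw [hx, hy]; ring
    have t1' : 0 ≤ 1 - t := by linarith
    have p0 : 0 ≤ F.σ (i + 1) * p 1 - p 0 := by rw [e0]; positivity
    have p1 : 0 ≤ p 0 - F.σ i * p 1 := by rw [e1]; positivity
    have hpos : 0 < p 1 := by
      rw [hy]
      rcases t0.lt_or_eq with h | rfl
      · have := mul_nonneg t1' h0.le
        positivity
      · simpa using h0
    refine ⟨hpos, by linarith, by linarith, ?_⟩
    have := F.gauge_mul hpos.le hi (by linarith) (by linarith)
    rw [e0, e1] at this
    field_simp at this
    linarith
  · rintro ⟨hpos, p0, p1, hg⟩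
    have := F.gauge_mul hpos.le hi p0 p1
    rw [hg, one_mul] at this
    have key : 1 - (F.h (i + 1))⁻¹ * (p 0 - F.σ i * p 1) / (F.σ (i + 1) - F.σ i) =
        (F.h i)⁻¹ * (F.σ (i + 1) * p 1 - p 0) / (F.σ (i + 1) - F.σ i) := by
      rw [eq_div_iff hσ.ne', sub_mul, div_mul_cancel₀ _ hσ.ne']
      linarith
    have q0 := sub_nonneg.2 p0
    have q1 := sub_nonneg.2 p1
    refine ⟨(F.h (i + 1))⁻¹ * (p 0 - F.σ i * p 1) / (F.σ (i + 1) - F.σ i), by positivity, ?_, ?_, ?_⟩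
    · rw [← sub_nonneg, key]; positivity
    · rw [key]; field_simp; ring
    · rw [key]; field_simp; ring

end Fan

namespace Fan

variable (F : Fan)

lemma index_cases {n i : ℕ} (hi : i < n + 4) :
    i = 0 ∨ (∃ j < n, i = j + 1) ∨ i = n + 1 ∨ i = n + 2 ∨ i = n + 3 := by
  rcases Nat.eq_zero_or_pos i with h | h
  · exact Or.inl h
  by_cases h' : i ≤ n
  · exact Or.inr (Or.inl ⟨i - 1, by omega, by omega⟩)
  · omega

lemma gap_pos : 0 < F.β - F.σ F.N := sub_pos.2 F.lt_β

lemma left_zero : 0 < F.left 0 := by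
  simpa [left_eq] using mul_pos F.hN_pos F.gap_pos

lemma right_zero : 0 < F.right 0 := by
  simpa [right_eq] using mul_pos F.hN_pos F.gap_pos

lemma left_node {i : ℕ} (hi : i < F.N) : 0 < F.left (F.node i) := F.left_pos i hi

lemma right_node {i : ℕ} (hi : i < F.N) : 0 < F.right (F.node i) := F.right_pos i hi

lemma left_node_last : F.left (F.node F.N) = 0 := by
  simp [left_eq, node]; ring

lemma right_node_last : 0 < F.right (F.node F.N) := by
  have := mul_pos F.hN_pos F.gap_pos
  simp only [right_eq, node, mkPt_zero, mkPt_one]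
  linarith

lemma left_top : 0 < F.left F.top := by
  have := mul_pos F.hN_pos F.gap_pos
  simp only [left_eq, top, mkPt_zero, mkPt_one]
  linarith

lemma right_top : F.right F.top = 0 := by
  simp [right_eq, top]; ring

lemma right_bottom : F.right F.bottom = 0 := by
  simp [right_eq, bottom]; ring

lemma eq_of_left {p a b : Pt} (hp : p ∈ segment ℝ a b) (ha : 0 < F.left a) (hb : 0 ≤ F.left b)
    (h : F.left p ≤ 0) : p = b ∧ F.left b = 0 := by
  rw [left_eq] at *
  exact eq_of_mem_segment_of_affine _ _ _ hp ha hb h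

lemma eq_of_right {p a b : Pt} (hp : p ∈ segment ℝ a b) (ha : 0 < F.right a) (hb : 0 ≤ F.right b)
    (h : F.right p ≤ 0) : p = b ∧ F.right b = 0 := by
  rw [right_eq] at *
  exact eq_of_mem_segment_of_affine _ _ _ hp ha hb h

lemma edge_first : segment ℝ (F.vert 0) (F.vert (0 + 1)) = segment ℝ 0 (F.node 0) := by
  rw [vert_zero, vert_succ F (Nat.zero_le _)]

lemma edge_chain {i : ℕ} (hi : i < F.N) : segment ℝ (F.vert (i + 1)) (F.vert (i + 1 + 1)) =
    segment ℝ (F.node i) (F.node (i + 1)) := by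
  rw [vert_succ F hi.le, vert_succ F hi]

lemma edge_left : segment ℝ (F.vert (F.N + 1)) (F.vert (F.N + 1 + 1)) =
    segment ℝ (F.node F.N) F.bottom := by
  rw [vert_succ F le_rfl, vert_bottom]

lemma edge_right : segment ℝ (F.vert (F.N + 2)) (F.vert (F.N + 2 + 1)) =
    segment ℝ F.bottom F.top := by
  rw [vert_bottom, vert_top]

lemma edge_last : segment ℝ (F.vert (F.N + 3)) (F.vert (F.N + 3 + 1)) = segment ℝ F.top 0 := by
  rw [vert_top, vert_last]

lemma edges_meet (i j : ℕ) (p : Pt) (hij : i < j) (hj : j < F.N + 4)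
    (hi' : p ∈ segment ℝ (F.vert i) (F.vert (i + 1)))
    (hj' : p ∈ segment ℝ (F.vert j) (F.vert (j + 1))) :
    (j = i + 1 ∧ p = F.vert j) ∨ (i = 0 ∧ j + 1 = F.N + 4 ∧ p = F.vert 0) := by
  have hN := F.one_le
  have hlast : ∀ k, k ≤ F.N → 0 ≤ F.left (F.node k) := fun k hk => by
    rcases hk.lt_or_eq with h | rfl
    · exact (F.left_node h).le
    · exact F.left_node_last.ge
  have hrt : ∀ k, k ≤ F.N → 0 < F.right (F.node k) := fun k hk => by
    rcases hk.lt_or_eq with h | rfl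
    · exact F.right_node h
    · exact F.right_node_last
  rcases index_cases (hij.trans hj) with rfl | ⟨k, hk, rfl⟩ | rfl | rfl | rfl
  · rw [edge_first] at hi'
    obtain ⟨y0, y1, hx⟩ := F.mem_firstEdge.1 hi'
    rcases index_cases hj with rfl | ⟨l, hl, rfl⟩ | rfl | rfl | rfl
    · omega
    · rw [F.edge_chain hl] at hj'
      obtain ⟨y2, h2, h3, h4⟩ := (F.mem_chainEdge hl).1 hj'
      have hl0 : l = 0 := by
        by_contra hne
        have := fan_strictMono F.σ_lt (Nat.pos_of_ne_zero hne) hl.le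
        rw [hx] at h2
        exact absurd (le_of_mul_le_mul_right h2 y2) (not_le.2 this)
      subst hl0
      have hg := F.gauge_mul y2.le hl h2 h3
      have hσ := sub_pos.2 (F.σ_lt 0 hl)
      have hy : p 1 = F.h 0 := by
        have hh := F.h_pos 0 (by omega)
        rw [h4, hx] at hg
        field_simp at hg
        have : (F.σ (0 + 1) - F.σ 0) * (p 1 - F.h 0) = 0 := by linear_combination -hg
        rcases mul_eq_zero.1 this with h | h <;> linarith
      left
      refine ⟨rfl, ?_⟩
      rw [vert_succ F (Nat.zero_le _)]
      exact ext_coord (by simp [node, hx, hy]) (by simp [node, hy])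
    · rw [edge_left] at hj'
      have h := F.eq_of_left hi' F.left_zero (hlast 0 (by omega)) (F.mem_leftEdge.1 hj').2.2.le
      exact absurd h.2 (F.left_node (by omega)).ne'
    · rw [edge_right] at hj'
      have h := F.eq_of_right hi' F.right_zero (hrt 0 (by omega)).le
        (F.mem_rightEdge.1 hj').2.2.le
      exact absurd h.2 (hrt 0 (by omega)).ne'
    · rw [edge_last] at hj'
      obtain ⟨y2, y3, hx'⟩ := F.mem_lastEdge.1 hj'
      right
      have hlt : F.σ 0 < F.β := (fan_mono F.σ_lt (Nat.zero_le _) le_rfl).trans_lt F.lt_β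
      have hy : p 1 = 0 := by
        have : (F.β - F.σ 0) * p 1 = 0 := by linear_combination hx - hx'
        rcases mul_eq_zero.1 this with h | h
        · linarith
        · exact h
      refine ⟨rfl, rfl, ?_⟩
      rw [vert_zero]
      exact ext_coord (by simp [hx, hy]) (by simp [hy])
  · rw [F.edge_chain hk] at hi'
    obtain ⟨y0, h0, h1, hg1⟩ := (F.mem_chainEdge hk).1 hi'
    rcases index_cases hj with rfl | ⟨l, hl, rfl⟩ | rfl | rfl | rfl
    · omega
    · rw [F.edge_chain hl] at hj'
      obtain ⟨y2, h2, h3, h4⟩ := (F.mem_chainEdge hl).1 hj'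
      have hle : F.σ l ≤ F.σ (k + 1) := le_of_mul_le_mul_right (h2.trans h1) y0
      have hl0 : l = k + 1 := by
        by_contra hne
        exact absurd hle (not_le.2 (fan_strictMono F.σ_lt (by omega) hl.le))
      subst hl0
      have hx : p 0 = F.σ (k + 1) * p 1 := le_antisymm h1 h2
      have hg := F.gauge_mul y0.le hl h2 h3
      have hσ := sub_pos.2 (F.σ_lt _ hl)
      have hy : p 1 = F.h (k + 1) := by
        have hh := F.h_pos (k + 1) (by omega)
        rw [h4, hx] at hg
        field_simp at hg
        have : (F.σ (k + 1 + 1) - F.σ (k + 1)) * (p 1 - F.h (k + 1)) = 0 := by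
          linear_combination -hg
        rcases mul_eq_zero.1 this with h | h <;> linarith
      left
      refine ⟨rfl, ?_⟩
      rw [vert_succ F hk]
      exact ext_coord (by simp [node, hx, hy]) (by simp [node, hy])
    · rw [edge_left] at hj'
      obtain ⟨h, h'⟩ := F.eq_of_left hi' (F.left_node hk) (hlast _ hk)
        (F.mem_leftEdge.1 hj').2.2.le
      have hkN : k + 1 = F.N := by
        by_contra hne
        exact absurd h' (F.left_node (by omega)).ne'
      left
      refine ⟨by omega, ?_⟩
      rw [vert_succ F le_rfl, h, hkN]
    · rw [edge_right] at hj'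
      have h := F.eq_of_right hi' (hrt k hk.le) (hrt _ hk).le (F.mem_rightEdge.1 hj').2.2.le
      exact absurd h.2 (hrt _ hk).ne'
    · rw [edge_last] at hj'
      obtain ⟨y2, y3, hx'⟩ := F.mem_lastEdge.1 hj'
      rw [hx'] at h1
      exact absurd (le_of_mul_le_mul_right h1 y0)
        (not_le.2 ((fan_mono F.σ_lt hk le_rfl).trans_lt F.lt_β))
  · rw [edge_left] at hi'
    rcases index_cases hj with rfl | ⟨l, hl, rfl⟩ | rfl | rfl | rfl
    · omega
    · omega
    · omega
    · rw [edge_right] at hj'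
      have h := F.eq_of_right hi' F.right_node_last F.right_bottom.ge
        (F.mem_rightEdge.1 hj').2.2.le
      left
      refine ⟨rfl, ?_⟩
      rw [vert_bottom, h.1]
    · rw [edge_last] at hj'
      have h := F.eq_of_left hj' F.left_top F.left_zero.le (F.mem_leftEdge.1 hi').2.2.le
      exact absurd h.2 F.left_zero.ne'
  · rw [edge_right] at hi'
    rcases index_cases hj with rfl | ⟨l, hl, rfl⟩ | rfl | rfl | rfl
    · omega
    · omega
    · omega
    · omega
    · rw [edge_last, segment_symm] at hj'
      have h := F.eq_of_right hj' F.right_zero F.right_top.ge (F.mem_rightEdge.1 hi').2.2.le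
      left
      refine ⟨rfl, ?_⟩
      rw [vert_top, h.1]
  · omega

lemma vert_ne {i j : ℕ} (hij : i < j) (hj : j < F.N + 4) : F.vert i ≠ F.vert j := by
  have hN := F.hN_pos
  intro h
  have hx := congrArg (fun p : Pt => p 0) h
  have hy := congrArg (fun p : Pt => p 1) h
  rcases index_cases (hij.trans hj) with rfl | ⟨k, hk, rfl⟩ | rfl | rfl | rfl <;>
    rcases index_cases hj with rfl | ⟨l, hl, rfl⟩ | rfl | rfl | rfl <;> try omega
  · rw [vert_zero, vert_succ F hl.le] at hy
    have := F.node_one_pos hl.le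
    simp at hy; linarith
  · rw [vert_zero, vert_succ F le_rfl] at hy
    have := F.node_one_pos le_rfl
    simp at hy; linarith
  · rw [vert_zero, vert_bottom] at hy
    simp [bottom] at hy; linarith
  · rw [vert_zero, vert_top] at hy
    simp [top] at hy; linarith
  · rw [vert_succ F hl.le, vert_succ F hk.le] at hx hy
    simp only [node, mkPt_zero, mkPt_one] at hx hy
    rw [hy] at hx
    exact (fan_strictMono F.σ_lt (by omega) hl.le).ne
      (mul_right_cancel₀ (F.h_pos l hl.le).ne' hx)
  · rw [vert_succ F hk.le, vert_succ F le_rfl] at hx hy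
    simp only [node, mkPt_zero, mkPt_one] at hx hy
    rw [hy] at hx
    exact (fan_strictMono F.σ_lt hk le_rfl).ne (mul_right_cancel₀ hN.ne' hx)
  · rw [vert_succ F hk.le, vert_bottom] at hy
    have := F.node_one_pos hk.le
    simp only [bottom, mkPt_one] at hy; linarith
  · rw [vert_succ F hk.le, vert_top] at hx hy
    simp only [node, top, mkPt_zero, mkPt_one] at hx hy
    rw [hy] at hx
    exact ((fan_mono F.σ_lt hk.le le_rfl).trans_lt F.lt_β).ne (mul_right_cancel₀ hN.ne' hx)
  · rw [vert_succ F le_rfl, vert_bottom] at hy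
    have := F.node_one_pos le_rfl
    simp only [bottom, mkPt_one] at hy; linarith
  · rw [vert_succ F le_rfl, vert_top] at hx
    simp only [node, top, mkPt_zero] at hx
    exact F.lt_β.ne (mul_right_cancel₀ hN.ne' hx)
  · rw [vert_top, vert_bottom] at hy
    simp only [bottom, top, mkPt_one] at hy; linarith

/-- The simple polygon given by a fan. -/
def polygon : SimplePolygon :=
  SimplePolygon.ofVertices (F.N + 4) (by omega) F.vert (by rw [vert_last, vert_zero])
    (fun i hi j hj h => by
      by_contra hne
      rcases lt_or_gt_of_ne hne with h' | h'
      · exact F.vert_ne h' hj h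
      · exact F.vert_ne h' hi h.symm) F.edges_meet

lemma polygon_ccw : F.polygon.CCW := by
  have hsum : ∀ i ∈ Finset.range F.N, det2 (F.vert (i + 1)) (F.vert (i + 1 + 1)) =
      F.h i * F.h (i + 1) * (F.σ i - F.σ (i + 1)) := fun i hi => by
    have hi := Finset.mem_range.1 hi
    rw [vert_succ F hi.le, vert_succ F hi]
    simp only [det2, node, mkPt_zero, mkPt_one]; ring
  unfold SimplePolygon.CCW polygon
  rw [SimplePolygon.shoelace_ofVertices, Finset.sum_range_succ, Finset.sum_range_succ,
    Finset.sum_range_succ, Finset.sum_range_succ', Finset.sum_congr rfl hsum, vert_succ F le_rfl,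
    vert_zero, vert_last, vert_top, vert_bottom]
  refine F.area_pos.trans_eq ?_
  simp only [det2, node, top, bottom, mkPt_zero, mkPt_one, PiLp.zero_apply]
  ring

lemma mem_boundary {p : Pt} : p ∈ F.polygon.boundary ↔
    (0 ≤ p 1 ∧ p 1 ≤ F.h 0 ∧ p 0 = F.σ 0 * p 1) ∨
    (0 < p 1 ∧ F.σ 0 * p 1 ≤ p 0 ∧ p 0 ≤ F.σ F.N * p 1 ∧ F.gauge p = 1) ∨
    (-F.h F.N ≤ p 1 ∧ p 1 ≤ F.h F.N ∧ F.left p = 0) ∨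
    (-F.h F.N ≤ p 1 ∧ p 1 ≤ F.h F.N ∧ F.right p = 0) ∨
    (0 ≤ p 1 ∧ p 1 ≤ F.h F.N ∧ p 0 = F.β * p 1) := by
  unfold polygon
  rw [SimplePolygon.mem_boundary_ofVertices, ← mem_firstEdge, ← mem_leftEdge, ← mem_rightEdge,
    ← mem_lastEdge]
  constructor
  · rintro ⟨i, hi, hp⟩
    rcases index_cases hi with rfl | ⟨k, hk, rfl⟩ | rfl | rfl | rfl
    · rw [edge_first] at hp
      exact Or.inl hp
    · rw [F.edge_chain hk] at hp
      obtain ⟨y0, h0, h1, hg⟩ := (F.mem_chainEdge hk).1 hp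
      refine Or.inr (Or.inl ⟨y0, le_trans ?_ h0, h1.trans ?_, hg⟩)
      · gcongr
        exact fan_mono F.σ_lt (Nat.zero_le _) hk.le
      · gcongr
        exact fan_mono F.σ_lt hk le_rfl
    · rw [edge_left] at hp
      simp [hp]
    · rw [edge_right] at hp
      simp [hp]
    · rw [edge_last] at hp
      simp [hp]
  · rintro (hp | ⟨y0, h0, h1, hg⟩ | hp | hp | hp)
    · exact ⟨0, by omega, by rwa [edge_first]⟩
    · obtain ⟨i, hi, h2, h3⟩ := exists_sector F.one_le h0 h1
      exact ⟨i + 1, by omega, by rw [F.edge_chain hi, F.mem_chainEdge hi]; exact ⟨y0, h2, h3, hg⟩⟩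
    · exact ⟨F.N + 1, by omega, by rwa [edge_left]⟩
    · exact ⟨F.N + 2, by omega, by rwa [edge_right]⟩
    · exact ⟨F.N + 3, by omega, by rwa [edge_last]⟩

end Fan

lemma norm_le_of_coord {p : Pt} {M : ℝ} (h0 : |p 0| ≤ M) (h1 : |p 1| ≤ M) : ‖p‖ ≤ 2 * M := by
  have hM : 0 ≤ M := (abs_nonneg _).trans h0
  refine abs_le_of_sq_le_sq' ?_ (by positivity) |>.2
  rw [EuclideanSpace.real_norm_sq_eq, Fin.sum_univ_two]
  have := sq_le_sq' (by linarith [abs_nonneg (p 0)]) h0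
  have := sq_le_sq' (by linarith [abs_nonneg (p 1)]) h1
  rw [sq_abs] at *
  nlinarith

lemma combo_pos {t a b : ℝ} (t0 : 0 ≤ t) (t1 : t ≤ 1) (ha : 0 < a) (hb : 0 < b) :
    0 < (1 - t) * a + t * b := by
  rcases t1.lt_or_eq with h | rfl
  · have := mul_pos (sub_pos.2 h) ha
    have := mul_nonneg t0 hb.le
    linarith
  · simpa

lemma SimplePolygon.notMem_region {P : SimplePolygon} {S : Set Pt} {b : Pt}
    (hS : IsPreconnected S) (hb : b ∈ S) (hdisj : ∀ p ∈ S, p ∉ P.boundary)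
    (hunb : ¬ Bornology.IsBounded S) : b ∉ P.region := by
  rintro (h | ⟨-, h⟩)
  · exact hdisj b hb h
  · exact hunb (h.subset (hS.subset_connectedComponentIn hb hdisj))

namespace Fan

variable (F : Fan)

@[fun_prop]
lemma continuous_left : Continuous F.left := by
  unfold left leftWall; fun_prop

@[fun_prop]
lemma continuous_right : Continuous F.right := by
  unfold right rightWall; fun_prop

@[fun_prop]
lemma continuous_gauge : Continuous F.gauge := continuous_fanGauge _ _ _

lemma left_eq_sub (p : Pt) : F.left p =
    4 * (p 0 - F.σ F.N * p 1) - (F.β - F.σ F.N) * (p 1 - F.h F.N) := by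
  rw [left_eq]; ring

lemma right_eq_sub (p : Pt) : F.right p =
    4 * (F.β * p 1 - p 0) - (F.β - F.σ F.N) * (p 1 - F.h F.N) := by
  rw [right_eq]; ring

lemma σ_zero_le : F.σ 0 ≤ F.σ F.N := fan_mono F.σ_lt (Nat.zero_le _) le_rfl

lemma σ_zero_lt : F.σ 0 < F.σ F.N := fan_strictMono F.σ_lt F.one_le le_rfl

lemma gauge_first {p : Pt} (hp : 0 ≤ p 1) (hx : p 0 = F.σ 0 * p 1) :
    F.gauge p = (F.h 0)⁻¹ * p 1 := by
  have hσ := F.σ_lt 0 F.one_le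
  have := F.gauge_mul hp F.one_le hx.ge (by rw [hx]; gcongr)
  refine mul_right_cancel₀ (sub_pos.2 hσ).ne' ?_
  rw [this, hx]; ring

lemma gauge_last {p : Pt} (hp : 0 ≤ p 1) (hx : p 0 = F.σ F.N * p 1) :
    F.gauge p = (F.h F.N)⁻¹ * p 1 :=
  fanGauge_top _ _ _ F.σ_lt p hp hx

/-- A sector of the plane disjoint from the region of the fan polygon. -/
def wedge : Set Pt := {p | 0 < p 1 ∧ F.σ F.N * p 1 < p 0 ∧ p 0 < F.β * p 1}

lemma convex_wedge : Convex ℝ F.wedge := by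
  rintro p ⟨p0, p1, p2⟩ q ⟨q0, q1, q2⟩ s t hs ht hst
  have hpos : ∀ u v : ℝ, 0 < u → 0 < v → 0 < s * u + t * v := fun u v hu hv => by
    obtain rfl : s = 1 - t := by linarith
    exact combo_pos ht (by linarith) hu hv
  refine ⟨?_, ?_, ?_⟩ <;> simp only [PiLp.add_apply, PiLp.smul_apply, smul_eq_mul]
  · exact hpos _ _ p0 q0
  · linarith [hpos _ _ (sub_pos.2 p1) (sub_pos.2 q1)]
  · linarith [hpos _ _ (sub_pos.2 p2) (sub_pos.2 q2)]

lemma mkPt_mem_wedge {y : ℝ} (hy : 0 < y) :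
    mkPt ((F.σ F.N + F.β) / 2 * y) y ∈ F.wedge := by
  have := F.lt_β
  refine ⟨by simpa using hy, ?_, ?_⟩ <;> simp only [mkPt_zero, mkPt_one] <;> gcongr <;> linarith

lemma not_isBounded_wedge : ¬ Bornology.IsBounded F.wedge := by
  intro h
  obtain ⟨M, hM⟩ := isBounded_iff_forall_norm_le.1 h
  have h1 := hM _ (F.mkPt_mem_wedge (y := |M| + 1) (by positivity))
  have h2 := (PiLp.norm_apply_le (mkPt ((F.σ F.N + F.β) / 2 * (|M| + 1)) (|M| + 1)) 1).trans h1
  rw [mkPt_one, Real.norm_eq_abs] at h2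
  linarith [le_abs_self (|M| + 1), le_abs_self M]

lemma notMem_boundary_of_wedge {p : Pt} (hp : p ∈ F.wedge) : p ∉ F.polygon.boundary := by
  obtain ⟨h0, h1, h2⟩ := hp
  have hg := F.gap_pos
  rw [mem_boundary]
  rintro (⟨-, -, h⟩ | ⟨-, -, h, -⟩ | ⟨-, h, h'⟩ | ⟨-, h, h'⟩ | ⟨-, -, h⟩)
  · rw [h] at h1
    exact absurd (lt_of_mul_lt_mul_right h1 h0.le) (not_lt.2 F.σ_zero_le)
  · linarith
  · rw [left_eq_sub] at h'
    have := mul_nonneg hg.le (sub_nonneg.2 h)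
    linarith
  · rw [right_eq_sub] at h'
    have := mul_nonneg hg.le (sub_nonneg.2 h)
    linarith
  · linarith

lemma notMem_region_of_wedge {b : Pt} (hb : b ∈ F.wedge) : b ∉ F.polygon.region :=
  SimplePolygon.notMem_region F.convex_wedge.isPreconnected hb
    (fun _ hp => F.notMem_boundary_of_wedge hp) F.not_isBounded_wedge

lemma notMem_boundary_of_gauge {p : Pt} (hl : 0 < F.left p) (hr : 0 < F.right p)
    (h0 : F.σ 0 * p 1 < p 0) (h1 : p 0 < F.β * p 1)
    (hg : p 0 ≤ F.σ F.N * p 1 → F.gauge p < 1) : p ∉ F.polygon.boundary := by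
  rw [mem_boundary]
  rintro (⟨-, -, h⟩ | ⟨-, -, h, h'⟩ | ⟨-, -, h⟩ | ⟨-, -, h⟩ | ⟨-, -, h⟩)
  · linarith
  · linarith [hg h]
  all_goals linarith

lemma gauge_smul {p : Pt} {t : ℝ} (ht : 0 ≤ t) (hp : 0 ≤ p 1) (h0 : F.σ 0 * p 1 ≤ p 0)
    (h1 : p 0 ≤ F.σ F.N * p 1) : F.gauge (t • p) = t * F.gauge p := by
  obtain ⟨i, hi, h2, h3⟩ := exists_sector F.one_le h0 h1
  have hσ := sub_pos.2 (F.σ_lt i hi)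
  have e := F.gauge_mul hp hi h2 h3
  have e' := F.gauge_mul (p := t • p) (by simpa using mul_nonneg ht hp) hi
    (by simpa [mul_left_comm] using mul_le_mul_of_nonneg_left h2 ht)
    (by simpa [mul_left_comm] using mul_le_mul_of_nonneg_left h3 ht)
  refine mul_right_cancel₀ hσ.ne' ?_
  rw [e', mul_assoc, e]
  simp only [PiLp.smul_apply, smul_eq_mul]
  ring

lemma gauge_lt_one {p : Pt} (hp : 0 < p 1) (h0 : F.σ 0 * p 1 ≤ p 0)
    (h1 : p 0 ≤ F.σ F.N * p 1) (hh : ∀ i ≤ F.N, p 1 < F.h i) : F.gauge p < 1 := by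
  obtain ⟨i, hi, h2, h3⟩ := exists_sector F.one_le h0 h1
  have hσ := sub_pos.2 (F.σ_lt i hi)
  have e := F.gauge_mul hp.le hi h2 h3
  have w : ∀ i ≤ F.N, (F.h i)⁻¹ < (p 1)⁻¹ := fun i hi => (inv_lt_inv₀ (F.h_pos i hi) hp).2 (hh i hi)
  have w0 := w i hi.le
  have w1 := w (i + 1) hi
  have hpp : (p 1)⁻¹ * p 1 = 1 := inv_mul_cancel₀ hp.ne'
  have key : F.gauge p * (F.σ (i + 1) - F.σ i) < 1 * (F.σ (i + 1) - F.σ i) := by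
    rw [e]
    have a0 := mul_le_mul_of_nonneg_right w0.le (sub_nonneg.2 h3)
    have a1 := mul_le_mul_of_nonneg_right w1.le (sub_nonneg.2 h2)
    have e1 : (p 1)⁻¹ * (F.σ (i + 1) * p 1 - p 0) + (p 1)⁻¹ * (p 0 - F.σ i * p 1) =
      1 * (F.σ (i + 1) - F.σ i) := by linear_combination (F.σ (i + 1) - F.σ i) * hpp
    rcases h2.lt_or_eq with h | h
    · have := mul_lt_mul_of_pos_right w1 (sub_pos.2 h)
      linarith
    · have h4 : 0 < F.σ (i + 1) * p 1 - p 0 := by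
        have := mul_pos hσ hp
        linarith
      have := mul_lt_mul_of_pos_right w0 h4
      linarith
  exact lt_of_mul_lt_mul_right key hσ.le

lemma left_pos_of_mem_segment {p a b : Pt} (hp : p ∈ segment ℝ a b) (ha : 0 < F.left a)
    (hb : 0 < F.left b) : 0 < F.left p := by
  by_contra h
  exact hb.ne' (F.eq_of_left hp ha hb.le (not_lt.1 h)).2

lemma right_pos_of_mem_segment {p a b : Pt} (hp : p ∈ segment ℝ a b) (ha : 0 < F.right a)
    (hb : 0 < F.right b) : 0 < F.right p := by
  by_contra h
  exact hb.ne' (F.eq_of_right hp ha hb.le (not_lt.1 h)).2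

open Filter Topology in
lemma notMem_region_of_gauge {b : Pt} (hl : 0 < F.left b) (hr : 0 < F.right b) (hy : 0 < b 1)
    (h0 : F.σ 0 * b 1 < b 0) (h1 : b 0 < F.σ F.N * b 1) (hg : F.gauge b < 1) :
    b ∉ F.polygon.region := by
  have hlt := F.lt_β
  have hgap := F.gap_pos
  set m := (F.σ F.N + F.β) / 2 with hm
  set c := mkPt (m * b 1) (b 1) with hc
  have hcont : ∀ f : Pt → ℝ, Continuous f → ∀ q : Pt, ∀ r, f 0 < r →
      ∀ᶠ t : ℝ in 𝓝[>] 0, f (t • q) < r := fun f hf q r h => by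
    have : Continuous fun t : ℝ => f (t • q) := by fun_prop
    refine (this.tendsto 0).mono_left nhdsWithin_le_nhds |>.eventually (gt_mem_nhds ?_)
    simpa using h
  have hcont' : ∀ f : Pt → ℝ, Continuous f → ∀ q : Pt, 0 < f 0 →
      ∀ᶠ t : ℝ in 𝓝[>] 0, 0 < f (t • q) := fun f hf q h => by
    filter_upwards [hcont (fun p => -f p) hf.neg q 0 (by linarith)] with t ht
    linarith
  have hev : ∀ᶠ t : ℝ in 𝓝[>] 0, (∀ i ∈ Finset.range (F.N + 1), (t • b) 1 < F.h i) ∧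
      0 < F.left (t • b) ∧ 0 < F.right (t • b) ∧ 0 < F.left (t • c) ∧ 0 < F.right (t • c) ∧
      0 < t ∧ t < 1 := by
    refine ((Finset.range (F.N + 1)).eventually_all.2 fun i hi => ?_).and
      ((hcont' _ F.continuous_left _ F.left_zero).and
      ((hcont' _ F.continuous_right _ F.right_zero).and
      ((hcont' _ F.continuous_left _ F.left_zero).and
      ((hcont' _ F.continuous_right _ F.right_zero).and
      (eventually_mem_nhdsWithin.and ((gt_mem_nhds one_pos).filter_mono nhdsWithin_le_nhds))))))
    exact hcont (fun p => p 1) (by fun_prop) b _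
      (by simpa using F.h_pos i (Nat.lt_succ_iff.1 (Finset.mem_range.1 hi)))
  obtain ⟨t, hh, l1, r1, l2, r2, t0, t1⟩ := hev.exists
  have hty : 0 < t * b 1 := mul_pos t0 hy
  have hcw : t • c ∈ F.wedge := by
    have : t • c = mkPt (m * (t * b 1)) (t * b 1) := by
      refine ext_coord ?_ ?_ <;> simp [hc]
      ring
    rw [this]; exact F.mkPt_mem_wedge hty
  have hS : IsPreconnected (segment ℝ b (t • b) ∪ segment ℝ (t • b) (t • c) ∪ F.wedge) := by
    refine IsPreconnected.union (t • c) (Or.inr (right_mem_segment _ _ _)) hcw ?_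
      F.convex_wedge.isPreconnected
    exact IsPreconnected.union (t • b) (right_mem_segment _ _ _) (left_mem_segment _ _ _)
      (convex_segment _ _).isPreconnected (convex_segment _ _).isPreconnected
  refine SimplePolygon.notMem_region hS (Or.inl (Or.inl (left_mem_segment _ _ _))) ?_
    fun h => F.not_isBounded_wedge (h.subset Set.subset_union_right)
  rintro p ((hp | hp) | hp)
  · have e1 := F.left_pos_of_mem_segment hp hl l1
    have e2 := F.right_pos_of_mem_segment hp hr r1
    obtain ⟨u, u0, u1, hx, hy'⟩ := mem_segment_iff_coord.1 hp
    have hv0 : 0 < (1 - u) + u * t := by simpa using combo_pos u0 u1 one_pos t0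
    have hv1 : (1 - u) + u * t ≤ 1 := by nlinarith
    have hpv : p = ((1 - u) + u * t) • b := by
      refine ext_coord ?_ ?_
      · rw [hx]; simp; ring
      · rw [hy']; simp; ring
    have hp0 : p 0 = ((1 - u) + u * t) * b 0 := by rw [hpv]; simp
    have hp1 : p 1 = ((1 - u) + u * t) * b 1 := by rw [hpv]; simp
    have k0 := mul_lt_mul_of_pos_left h0 hv0
    have k1 := mul_lt_mul_of_pos_left h1 hv0
    have k2 : F.σ F.N * p 1 < F.β * p 1 := by
      rw [hp1]
      exact mul_lt_mul_of_pos_right hlt (mul_pos hv0 hy)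
    refine F.notMem_boundary_of_gauge e1 e2 (by rw [hp0, hp1]; linarith)
      (lt_trans ?_ k2) fun _ => ?_
    · rw [hp0, hp1]; linarith
    · rw [hpv, F.gauge_smul hv0.le hy.le h0.le h1.le]
      nlinarith
  · have e1 := F.left_pos_of_mem_segment hp l1 l2
    have e2 := F.right_pos_of_mem_segment hp r1 r2
    obtain ⟨u, u0, u1, hx, hy'⟩ := mem_segment_iff_coord.1 hp
    simp only [hc, PiLp.smul_apply, mkPt_zero, mkPt_one, smul_eq_mul] at hx hy' hh
    have hp1 : p 1 = t * b 1 := by rw [hy']; ring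
    have hs := F.σ_zero_lt
    have hm0 : F.σ 0 * b 1 < m * b 1 := mul_lt_mul_of_pos_right (by linarith) hy
    have hmb : m * b 1 < F.β * b 1 := mul_lt_mul_of_pos_right (by linarith) hy
    have hbb : F.σ F.N * b 1 < F.β * b 1 := mul_lt_mul_of_pos_right (by linarith) hy
    have q0 : F.σ 0 * p 1 < p 0 := by
      rw [hp1, hx]
      have := combo_pos u0 u1 (sub_pos.2 (mul_lt_mul_of_pos_left h0 t0))
        (sub_pos.2 (mul_lt_mul_of_pos_left hm0 t0))
      linarith
    have q1 : p 0 < F.β * p 1 := by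
      rw [hp1, hx]
      have := combo_pos u0 u1 (sub_pos.2 (mul_lt_mul_of_pos_left (h1.trans hbb) t0))
        (sub_pos.2 (mul_lt_mul_of_pos_left hmb t0))
      linarith
    refine F.notMem_boundary_of_gauge e1 e2 q0 q1 fun h => ?_
    exact F.gauge_lt_one (by rwa [hp1]) q0.le h fun i hi => by
      rw [hp1]; exact hh i (Finset.mem_range.2 (by omega))
  · exact F.notMem_boundary_of_wedge hp

end Fan

namespace Fan

variable (F : Fan)

/-- A bounded open set whose complement contains the boundary of the fan polygon. -/
def core : Set Pt := {p | 0 < F.left p ∧ 0 < F.right p ∧ (p 0 < F.σ 0 * p 1 ∨ F.β * p 1 < p 0 ∨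
  p 1 < 0 ∨ (0 < p 1 ∧ p 0 < F.σ F.N * p 1 ∧ 1 < F.gauge p))}

/-- The points not in the core and not on the boundary. -/
def outer : Set Pt := {p | F.left p < 0 ∨ F.right p < 0 ∨ (0 < p 1 ∧ F.σ 0 * p 1 < p 0 ∧
  p 0 < F.β * p 1 ∧ (F.gauge p < 1 ∨ F.σ F.N * p 1 < p 0))}

lemma isOpen_core : IsOpen F.core := by
  have h : F.core = {p | 0 < F.left p} ∩ ({p | 0 < F.right p} ∩ ({p | p 0 < F.σ 0 * p 1} ∪
      ({p | F.β * p 1 < p 0} ∪ ({p | p 1 < 0} ∪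
      ({p | 0 < p 1} ∩ ({p | p 0 < F.σ F.N * p 1} ∩ {p | 1 < F.gauge p})))))) := rfl
  rw [h]
  repeat' first
    | exact isOpen_lt (by fun_prop) (by fun_prop)
    | apply IsOpen.inter
    | apply IsOpen.union

lemma isOpen_outer : IsOpen F.outer := by
  have h : F.outer = {p | F.left p < 0} ∪ ({p | F.right p < 0} ∪ ({p | 0 < p 1} ∩
      ({p | F.σ 0 * p 1 < p 0} ∩ ({p | p 0 < F.β * p 1} ∩
      ({p | F.gauge p < 1} ∪ {p | F.σ F.N * p 1 < p 0}))))) := rfl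
  rw [h]
  repeat' first
    | exact isOpen_lt (by fun_prop) (by fun_prop)
    | apply IsOpen.inter
    | apply IsOpen.union

lemma disjoint_core_outer : Disjoint F.core F.outer := by
  rw [Set.disjoint_left]
  rintro p ⟨hl, hr, hp⟩ (h | h | ⟨h0, h1, h2, h3⟩)
  · linarith
  · linarith
  · rcases hp with h | h | h | ⟨-, h4, h5⟩
    · linarith
    · linarith
    · linarith
    · rcases h3 with h | h <;> linarith

lemma compl_boundary_subset : F.polygon.boundaryᶜ ⊆ F.core ∪ F.outer := by
  intro p hp
  rw [Set.mem_compl_iff, mem_boundary] at hp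
  push Not at hp
  obtain ⟨b1, b2, b3, b4, b5⟩ := hp
  have hL := F.hN_pos
  have hgap := F.gap_pos
  have hs := F.σ_zero_le
  have hst := F.σ_zero_lt
  have hβ := F.lt_β
  by_contra hnot
  simp only [core, outer, Set.mem_union, Set.mem_ofPred_eq, not_or, not_and_or, not_lt] at hnot
  obtain ⟨hc, hl, hr, ho⟩ := hnot
  have el := F.left_eq_sub p
  have er := F.right_eq_sub p
  have hlow : -F.h F.N ≤ p 1 := by
    have : 0 ≤ (F.β - F.σ F.N) * (p 1 + F.h F.N) := by linarith
    have := nonneg_of_mul_nonneg_right this hgap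
    linarith
  have hhigh : p 1 ≤ F.h F.N := by
    by_contra! h
    have h' := mul_pos hgap (sub_pos.2 h)
    have hy : 0 < p 1 := hL.trans h
    have h1 := mul_le_mul_of_nonneg_right hs hy.le
    rcases ho with h | h | h | ⟨-, h⟩ <;> linarith
  have hl' : 0 < F.left p := lt_of_le_of_ne hl (Ne.symm (b3 hlow hhigh))
  have hr' : 0 < F.right p := lt_of_le_of_ne hr (Ne.symm (b4 hlow hhigh))
  rcases hc with h | h | ⟨c1, c2, c3, c4⟩
  · linarith
  · linarith
  rcases c3.lt_or_eq with hy | hy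
  · rcases c1.lt_or_eq with hx | hx
    · rcases c2.lt_or_eq with hx' | hx'
      · rcases ho with h | h | h | ⟨h, h'⟩
        · linarith
        · linarith
        · linarith
        · rcases c4 with h4 | h4 | h4
          · linarith
          · have hx3 : p 0 = F.σ F.N * p 1 := le_antisymm h' h4
            rw [F.gauge_last hy.le hx3, ← div_eq_inv_mul, one_le_div hL] at h
            have := le_antisymm h hhigh
            rw [this] at el
            linarith
          · exact b2 hy hx.le h' (le_antisymm h4 h)
      · exact b5 hy.le hhigh hx'
    · have h1 := b1 hy.le
      have h2 : F.h 0 < p 1 := by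
        by_contra! h
        exact h1 h hx.symm
      rcases c4 with h4 | h4 | h4
      · linarith
      · rw [← hx] at h4
        exact absurd (le_of_mul_le_mul_right h4 hy) (not_le.2 hst)
      · rw [F.gauge_first hy.le hx.symm, ← div_eq_inv_mul, div_le_one (F.h_pos 0 (by omega))] at h4
        linarith
  · rw [← hy] at c1 c2
    exact b1 hy.le (by rw [← hy]; exact (F.h_pos 0 (by omega)).le) (by rw [← hy]; linarith)

lemma isBounded_core : Bornology.IsBounded F.core := by
  have hL := F.hN_pos
  have hgap := F.gap_pos
  set L := F.h F.N with hLdef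
  set a := F.σ F.N with ha
  set M := L + L * (F.β - a) + |3 * a + F.β| * L + |3 * F.β + a| * L with hM
  refine isBounded_iff_forall_norm_le.2 ⟨2 * M, ?_⟩
  rintro p ⟨hl, hr, hp⟩
  have el := F.left_eq_sub p
  have er := F.right_eq_sub p
  have el' := F.left_eq p
  have er' := F.right_eq p
  rw [← hLdef, ← ha] at el er el' er'
  have hlow : -L ≤ p 1 := by
    have : 0 ≤ (F.β - a) * (p 1 + L) := by linarith
    have := nonneg_of_mul_nonneg_right this hgap
    linarith
  have hhigh : p 1 ≤ L := by
    by_contra! h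
    have h' := mul_pos hgap (sub_pos.2 h)
    have hy : 0 < p 1 := hL.trans h
    have h1 := mul_le_mul_of_nonneg_right F.σ_zero_le hy.le
    rw [← ha] at h1
    rcases hp with h | h | h | ⟨-, h, -⟩ <;> linarith
  have hy : |p 1| ≤ L := abs_le.2 ⟨hlow, hhigh⟩
  have k1 : |(3 * a + F.β) * p 1| ≤ |3 * a + F.β| * L := by
    rw [abs_mul]; gcongr
  have k2 : |(3 * F.β + a) * p 1| ≤ |3 * F.β + a| * L := by
    rw [abs_mul]; gcongr
  have k3 : 0 < L * (F.β - a) := mul_pos hL hgap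
  have k4 : 0 ≤ |3 * a + F.β| * L := by positivity
  have k5 : 0 ≤ |3 * F.β + a| * L := by positivity
  obtain ⟨k6, k7⟩ := abs_le.1 k1
  obtain ⟨k8, k9⟩ := abs_le.1 k2
  exact norm_le_of_coord (abs_le.2 ⟨by linarith, by linarith⟩) (by linarith)

lemma core_subset_compl_boundary : F.core ⊆ F.polygon.boundaryᶜ := by
  rintro p ⟨hl, hr, hp⟩ hb
  have hs : 0 ≤ p 1 → F.σ 0 * p 1 ≤ F.σ F.N * p 1 := fun h =>
    mul_le_mul_of_nonneg_right F.σ_zero_le h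
  have hβ : 0 ≤ p 1 → F.σ F.N * p 1 ≤ F.β * p 1 := fun h => mul_le_mul_of_nonneg_right F.lt_β.le h
  rw [mem_boundary] at hb
  rcases hb with ⟨h0, h1, h2⟩ | ⟨h0, h1, h2, h3⟩ | ⟨-, -, h⟩ | ⟨-, -, h⟩ | ⟨h0, h1, h2⟩
  · have := hs h0
    have := hβ h0
    rcases hp with h | h | h | ⟨-, h, h'⟩
    · linarith
    · linarith
    · linarith
    · rw [F.gauge_first h0 h2, ← div_eq_inv_mul, one_lt_div (F.h_pos 0 (by omega))] at h'
      linarith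
  · have := hβ h0.le
    rcases hp with h | h | h | ⟨-, h, h'⟩ <;> linarith
  · linarith
  · linarith
  · have := hs h0
    have := hβ h0
    rcases hp with h | h | h | ⟨-, h, h'⟩ <;> linarith

lemma mem_interior_of_core {p : Pt} (hp : p ∈ F.core) : p ∈ F.polygon.interior := by
  have hb := F.core_subset_compl_boundary hp
  refine ⟨hb, F.isBounded_core.subset ?_⟩
  exact isPreconnected_connectedComponentIn.subset_left_of_subset_union F.isOpen_core F.isOpen_outer
    F.disjoint_core_outer ((connectedComponentIn_subset _ _).trans F.compl_boundary_subset)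
    ⟨p, mem_connectedComponentIn hb, hp⟩

lemma vtx_polygon {i : ℕ} (hi : i ≤ F.N + 4) : F.polygon.vtx i = F.vert i :=
  SimplePolygon.vtx_ofVertices _ _ _ _ _ _ hi

lemma numConvex_le {K : ℕ} {T η : ℝ} (hN : F.N = 2 * K) (hη : η < T)
    (htip : ∀ a < K, F.h (2 * a) = T) (hcorner : ∀ a < K, F.h (2 * a + 1) = η) :
    F.polygon.numConvex ≤ K + 3 := by
  have hn : F.polygon.n = 2 * K + 4 := by rw [← hN]; rfl
  have hNpos := F.one_le
  have hsub : {i | i < F.polygon.n ∧ F.polygon.ConvexAt i} ⊆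
      ((Finset.range K).image fun a => 2 * a + 1) ∪ {2 * K, 2 * K + 1, 2 * K + 2} := by
    rintro i ⟨hi, hc⟩
    rw [hn] at hi
    by_contra hmem
    simp only [Finset.coe_image, Set.mem_union, Set.mem_image, Finset.coe_range, Set.mem_Iio,
      Set.mem_insert_iff, Set.mem_singleton_iff, not_or, not_exists, not_and] at hmem
    obtain ⟨hodd, h1, h2, h3⟩ := hmem
    have hcases : i = 2 * K + 3 ∨ ∃ a < K, i = 2 * a := by
      by_cases h : i = 2 * K + 3
      · exact Or.inl h
      · rcases Nat.even_or_odd' i with ⟨a, rfl | rfl⟩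
        · exact Or.inr ⟨a, by omega, rfl⟩
        · exact absurd rfl (hodd a (by omega))
    unfold SimplePolygon.ConvexAt at hc
    have hσ0 := F.σ_zero_le.trans_lt F.lt_β
    have h0 := F.h_pos 0 (by omega)
    rcases hcases with rfl | ⟨a, ha, rfl⟩
    · have e : F.polygon.vtx (2 * K + 3 + 2) = F.vert 1 := by
        rw [← hN]; exact SimplePolygon.vtx_ofVertices_succ _ _ _ _ _ _
      rw [e, ← hN, vtx_polygon F le_rfl, vtx_polygon F (by omega), vert_last, vert_top,
        vert_succ F (Nat.zero_le _)] at hc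
      simp only [det2, top, node, mkPt_zero, mkPt_one, PiLp.sub_apply, PiLp.zero_apply] at hc
      have := mul_pos (mul_pos F.hN_pos h0) (sub_pos.2 hσ0)
      linarith
    · rw [vtx_polygon F (by omega), vtx_polygon F (by omega), vtx_polygon F (by omega),
        vert_succ F (by omega), vert_succ F (i := 2 * a + 1) (by omega)] at hc
      have hη0 : 0 < η := by rw [← hcorner a ha]; exact F.h_pos _ (by omega)
      have s1 := F.σ_lt (2 * a) (by omega)
      rcases Nat.eq_zero_or_pos a with rfl | hapos
      · rw [Nat.mul_zero, vert_zero] at hc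
        have h1 := F.h_pos 1 (by omega)
        simp only [det2, node, mkPt_zero, mkPt_one, PiLp.sub_apply, PiLp.zero_apply, mul_zero,
          zero_add] at hc s1
        have := mul_pos (mul_pos h0 h1) (sub_pos.2 s1)
        linarith
      · obtain ⟨b, rfl⟩ : ∃ b, a = b + 1 := ⟨a - 1, by omega⟩
        rw [show 2 * (b + 1) = 2 * b + 1 + 1 by ring, vert_succ F (by omega)] at hc
        have s2 := F.σ_lt (2 * b + 1) (by omega)
        have t1 := htip (b + 1) ha
        have t2 := hcorner (b + 1) ha
        have t3 := hcorner b (by omega)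
        rw [show 2 * (b + 1) = 2 * b + 1 + 1 by ring] at t1 t2 s1
        simp only [det2, node, mkPt_zero, mkPt_one, PiLp.sub_apply, t1, t2, t3] at hc
        have := mul_pos (mul_pos hη0 (sub_pos.2 hη)) (sub_pos.2 (s2.trans s1))
        linarith
  have hcard : {i | i < F.polygon.n ∧ F.polygon.ConvexAt i}.ncard ≤
      (((Finset.range K).image fun a => 2 * a + 1) ∪ {2 * K, 2 * K + 1, 2 * K + 2}).card := by
    rw [← Set.ncard_coe_finset]
    exact Set.ncard_le_ncard (by simpa using hsub) (Finset.finite_toSet _)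
  refine hcard.trans ((Finset.card_union_le _ _).trans (Nat.add_le_add ?_ Finset.card_le_three))
  exact Finset.card_image_le.trans (Finset.card_range K).le

end Fan

/-- The slopes of a fan with tips near the rays `x = τ a * y`. -/
def combσ (τ : ℕ → ℝ) (K : ℕ) (ε : ℝ) (i : ℕ) : ℝ :=
  if i % 2 = 0 then τ (i / 2) - (if i / 2 = K then 0 else ε) else (τ (i / 2) + τ (i / 2 + 1)) / 2

/-- The heights of a fan with tips of height `T` and corners of height `η`. -/
def combh (K : ℕ) (T η L : ℝ) (i : ℕ) : ℝ :=
  if i % 2 = 0 then (if i / 2 = K then L else T) else η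

lemma combσ_even (τ : ℕ → ℝ) (K : ℕ) (ε : ℝ) (a : ℕ) :
    combσ τ K ε (2 * a) = τ a - (if a = K then 0 else ε) := by
  have h : 2 * a / 2 = a := by omega
  simp [combσ, h]

lemma combσ_odd (τ : ℕ → ℝ) (K : ℕ) (ε : ℝ) (a : ℕ) :
    combσ τ K ε (2 * a + 1) = (τ a + τ (a + 1)) / 2 := by
  have h : (2 * a + 1) / 2 = a := by omega
  simp [combσ, h]

lemma combh_tip {K : ℕ} (T η L : ℝ) {a : ℕ} (ha : a < K) : combh K T η L (2 * a) = T := by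
  have h : 2 * a / 2 = a := by omega
  simp [combh, h, ha.ne]

lemma combh_last (K : ℕ) (T η L : ℝ) : combh K T η L (2 * K) = L := by
  have h : 2 * K / 2 = K := by omega
  simp [combh, h]

lemma combh_odd (K : ℕ) (T η L : ℝ) (a : ℕ) : combh K T η L (2 * a + 1) = η := by
  simp [combh]

lemma combσ_lt {τ : ℕ → ℝ} {K : ℕ} {ε : ℝ} (hε : 0 < ε)
    (hτ : ∀ a < K, ε < (τ (a + 1) - τ a) / 2) :
    ∀ i < 2 * K, combσ τ K ε i < combσ τ K ε (i + 1) := by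
  intro i hi
  rcases Nat.even_or_odd' i with ⟨a, rfl | rfl⟩
  · have ha : a < K := by omega
    have := hτ a ha
    rw [combσ_even, combσ_odd, if_neg ha.ne]
    linarith
  · have ha : a < K := by omega
    have := hτ a ha
    rw [combσ_odd, show 2 * a + 1 + 1 = 2 * (a + 1) by ring, combσ_even]
    split_ifs <;> linarith

open Filter Topology in
lemma eventually_mul_lt (C : ℝ) {c : ℝ} (hc : 0 < c) : ∀ᶠ t : ℝ in 𝓝[>] 0, t * C < c := by
  have : Continuous fun t : ℝ => t * C := by fun_prop
  refine (this.tendsto 0).mono_left nhdsWithin_le_nhds |>.eventually (gt_mem_nhds ?_)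
  simpa using hc

open Filter Topology in
lemma eventually_walls {a β : ℝ} (h : a < β) (p : Pt) :
    ∀ᶠ L : ℝ in atTop, 0 < leftWall a β L p ∧ 0 < rightWall a β L p := by
  have ht : Tendsto (fun L : ℝ => L * (β - a)) atTop atTop :=
    tendsto_id.atTop_mul_const (sub_pos.2 h)
  filter_upwards [ht.eventually_gt_atTop (-(4 * p 0 - (3 * a + β) * p 1)),
    ht.eventually_gt_atTop (-(-4 * p 0 + (3 * β + a) * p 1))] with L h1 h2
  unfold leftWall rightWall
  exact ⟨by linarith, by linarith⟩

namespace Fan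

lemma gauge_lt_of_tip (F : Fan) {i : ℕ} (hi : i < F.N) {p : Pt} (hp : 0 < p 1)
    (hT : 2 * p 1 ≤ F.h i) (h0 : F.σ i * p 1 < p 0) (h1 : p 0 ≤ F.σ (i + 1) * p 1)
    (h2 : 2 * (p 0 - F.σ i * p 1) * p 1 ≤ F.h (i + 1) * (F.σ (i + 1) * p 1 - p 0)) :
    F.gauge p < 1 := by
  have hσ := sub_pos.2 (F.σ_lt i hi)
  have hh := F.h_pos i hi.le
  have hh' := F.h_pos (i + 1) hi
  have e := F.gauge_mul hp.le hi h0.le h1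
  have a1 : (F.h i)⁻¹ * (F.σ (i + 1) * p 1 - p 0) ≤ (F.σ (i + 1) * p 1 - p 0) / (2 * p 1) := by
    rw [← div_eq_inv_mul]
    have := sub_nonneg.2 h1
    gcongr
  have a2 : (F.h (i + 1))⁻¹ * (p 0 - F.σ i * p 1) ≤ (F.σ (i + 1) * p 1 - p 0) / (2 * p 1) := by
    rw [← div_eq_inv_mul, div_le_div_iff₀ hh' (by positivity)]
    linarith
  have a3 : (F.σ (i + 1) * p 1 - p 0) / (2 * p 1) + (F.σ (i + 1) * p 1 - p 0) / (2 * p 1) <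
      F.σ (i + 1) - F.σ i := by
    rw [← add_div, div_lt_iff₀ (by positivity)]
    linarith
  have key : F.gauge p * (F.σ (i + 1) - F.σ i) < 1 * (F.σ (i + 1) - F.σ i) := by linarith
  exact lt_of_mul_lt_mul_right key hσ.le

lemma one_lt_gauge_of_left (F : Fan) {i : ℕ} (hi : i < F.N) {p : Pt} (hp : 0 < p 1)
    (h0 : F.σ i * p 1 ≤ p 0) (h1 : p 0 ≤ F.σ (i + 1) * p 1)
    (h2 : F.h (i + 1) * (F.σ (i + 1) - F.σ i) < p 0 - F.σ i * p 1) : 1 < F.gauge p := by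
  have hσ := sub_pos.2 (F.σ_lt i hi)
  have hh := F.h_pos i hi.le
  have hh' := F.h_pos (i + 1) hi
  have e := F.gauge_mul hp.le hi h0 h1
  have a1 : 0 ≤ (F.h i)⁻¹ * (F.σ (i + 1) * p 1 - p 0) :=
    mul_nonneg (inv_nonneg.2 hh.le) (sub_nonneg.2 h1)
  have a2 : F.σ (i + 1) - F.σ i < (F.h (i + 1))⁻¹ * (p 0 - F.σ i * p 1) := by
    rw [← div_eq_inv_mul, lt_div_iff₀ hh']
    linarith
  have key : 1 * (F.σ (i + 1) - F.σ i) < F.gauge p * (F.σ (i + 1) - F.σ i) := by linarith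
  exact lt_of_mul_lt_mul_right key hσ.le

lemma one_lt_gauge_of_right (F : Fan) {i : ℕ} (hi : i < F.N) {p : Pt} (hp : 0 < p 1)
    (h0 : F.σ i * p 1 ≤ p 0) (h1 : p 0 ≤ F.σ (i + 1) * p 1)
    (h2 : F.h i * (F.σ (i + 1) - F.σ i) < F.σ (i + 1) * p 1 - p 0) : 1 < F.gauge p := by
  have hσ := sub_pos.2 (F.σ_lt i hi)
  have hh := F.h_pos i hi.le
  have hh' := F.h_pos (i + 1) hi
  have e := F.gauge_mul hp.le hi h0 h1
  have a1 : 0 ≤ (F.h (i + 1))⁻¹ * (p 0 - F.σ i * p 1) :=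
    mul_nonneg (inv_nonneg.2 hh'.le) (sub_nonneg.2 h0)
  have a2 : F.σ (i + 1) - F.σ i < (F.h i)⁻¹ * (F.σ (i + 1) * p 1 - p 0) := by
    rw [← div_eq_inv_mul, lt_div_iff₀ hh]
    linarith
  have key : 1 * (F.σ (i + 1) - F.σ i) < F.gauge p * (F.σ (i + 1) - F.σ i) := by linarith
  exact lt_of_mul_lt_mul_right key hσ.le

/-- Given the rays `x = τ a * y`, a comb-like fan. -/
lemma exists_comb {K : ℕ} (hK : 1 ≤ K) {τ : ℕ → ℝ} {β ε T η : ℝ} (hβ : τ K < β) (hε : 0 < ε)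
    (hτ : ∀ a < K, ε < (τ (a + 1) - τ a) / 2) (hη : 0 < η) (hηT : η < T) (Q : Finset Pt) :
    ∃ F : Fan, F.N = 2 * K ∧ F.β = β ∧ F.σ = combσ τ K ε ∧
      (∀ a < K, F.h (2 * a) = T) ∧ (∀ a < K, F.h (2 * a + 1) = η) ∧
      ∀ p ∈ Q, 0 < F.left p ∧ 0 < F.right p := by
  have hT : 0 < T := hη.trans hηT
  have hgap := sub_pos.2 hβ
  have hσN : combσ τ K ε (2 * K) = τ K := by simp [combσ_even]
  have hmono := combσ_lt hε hτ
  have hev : ∀ᶠ L : ℝ in Filter.atTop, T < L ∧ T * (τ K - combσ τ K ε 0) < L * (β - τ K) ∧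
      (∀ p ∈ Q, 0 < leftWall (τ K) β L p ∧ 0 < rightWall (τ K) β L p) ∧
      ∀ i ∈ Finset.range (2 * K), 0 < leftWall (τ K) β L
          (mkPt (combσ τ K ε i * combh K T η 0 i) (combh K T η 0 i)) ∧
        0 < rightWall (τ K) β L (mkPt (combσ τ K ε i * combh K T η 0 i) (combh K T η 0 i)) := by
    refine (Filter.eventually_gt_atTop T).and (((Filter.tendsto_id.atTop_mul_const
      hgap).eventually_gt_atTop _).and (((Finset.eventually_all _).2 fun p _ =>
      eventually_walls hβ p).and ((Finset.eventually_all _).2 fun i _ => eventually_walls hβ _)))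
  obtain ⟨L, hTL, harea, hQ, hnodes⟩ := hev.exists
  have hL : 0 < L := hT.trans hTL
  have hcomb : ∀ i < 2 * K, combh K T η L i = combh K T η 0 i := fun i hi => by
    unfold combh
    split_ifs <;> first | rfl | omega
  have hlow : ∀ i < 2 * K, combh K T η L i ≤ T := fun i hi => by
    unfold combh
    split_ifs
    · omega
    · exact le_rfl
    · exact hηT.le
  have hhigh : ∀ i, combh K T η L i ≤ L := fun i => by
    unfold combh
    split_ifs
    · exact le_rfl
    · exact hTL.le
    · exact (hηT.trans hTL).le
  have hpos : ∀ i, 0 < combh K T η L i := fun i => by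
    unfold combh
    split_ifs <;> assumption
  refine ⟨⟨2 * K, by omega, combσ τ K ε, combh K T η L, β, hmono, fun i _ => hpos i, by rwa [hσN],
    fun i hi => ?_, fun i hi => ?_, ?_⟩, rfl, rfl, rfl, fun a ha => combh_tip _ _ _ ha,
    fun a _ => combh_odd _ _ _ _ _, fun p hp => ?_⟩
  · rw [hσN, combh_last, hcomb i hi]
    exact (hnodes i (Finset.mem_range.2 hi)).1
  · rw [hσN, combh_last, hcomb i hi]
    exact (hnodes i (Finset.mem_range.2 hi)).2
  · rw [combh_last, hσN]
    have h1 : ∑ i ∈ Finset.range (2 * K), T * L * (combσ τ K ε i - combσ τ K ε (i + 1)) ≤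
        ∑ i ∈ Finset.range (2 * K), combh K T η L i * combh K T η L (i + 1) *
          (combσ τ K ε i - combσ τ K ε (i + 1)) := by
      refine Finset.sum_le_sum fun i hi => ?_
      have hi := Finset.mem_range.1 hi
      refine mul_le_mul_of_nonpos_right ?_ (sub_nonpos.2 (hmono i hi).le)
      exact mul_le_mul (hlow i hi) (hhigh _) (hpos _).le hT.le
    rw [← Finset.mul_sum, Finset.sum_range_sub', hσN] at h1
    have h2 := mul_pos hL (sub_pos.2 harea)
    linarith
  · unfold left right
    simp only [hσN, combh_last]
    exact hQ p hp

end Fan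

open Filter Topology in
/-- Points on finitely many rays can be separated, by a fan, from points off these rays. -/
lemma Fan.exists_separating {K : ℕ} (hK : 1 ≤ K) {τ : ℕ → ℝ} (hτ : ∀ a < K, τ a < τ (a + 1))
    {β : ℝ} (hβ : τ K < β) {B R : Finset Pt}
    (hB : ∀ b ∈ B, 0 < b 1 ∧ ∃ a < K, b 0 = τ a * b 1)
    (hR : ∀ r ∈ R, r 1 < 0 ∨ (0 < r 1 ∧ r 0 < τ K * r 1 ∧ ∀ a < K, r 0 ≠ τ a * r 1)) :
    ∃ F : Fan, F.N = 2 * K ∧ F.σ F.N = τ K ∧ F.β = β ∧ F.polygon.numConvex ≤ K + 3 ∧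
      (∀ b ∈ B, b ∉ F.polygon.region) ∧ ∀ r ∈ R, r ∈ F.polygon.interior := by
  obtain ⟨T, hT0, hT⟩ : ∃ T : ℝ, 0 < T ∧ ∀ b ∈ B, 2 * b 1 ≤ T := by
    refine ⟨2 * ∑ b ∈ B, b 1 + 1, ?_, fun b hb => ?_⟩
    · have := Finset.sum_nonneg fun b hb => (hB b hb).1.le
      linarith
    · have := Finset.single_le_sum (f := fun b : Pt => b 1) (fun b hb => (hB b hb).1.le) hb
      linarith
  have hne : ∀ r ∈ R, 0 < r 1 → ∀ a ∈ Finset.range (K + 1), 0 < |r 0 - τ a * r 1| / 2 := by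
    intro r hr hr1 a ha
    refine half_pos (abs_pos.2 (sub_ne_zero.2 ?_))
    rcases hR r hr with h | ⟨-, h1, h2⟩
    · linarith
    · rcases Nat.lt_succ_iff_lt_or_eq.1 (Finset.mem_range.1 ha) with h | rfl
      · exact h2 a h
      · exact h1.ne
  have hη : ∀ᶠ η : ℝ in 𝓝[>] 0, η * 1 < T ∧ ∀ r ∈ R, 0 < r 1 → ∀ a ∈ Finset.range (K + 1),
      η * (τ K - τ 0 + 1) < |r 0 - τ a * r 1| / 2 := by
    refine (eventually_mul_lt 1 hT0).and ((Finset.eventually_all _).2 fun r hr => ?_)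
    by_cases hr1 : 0 < r 1
    · filter_upwards [(Finset.eventually_all _).2 fun a ha =>
        eventually_mul_lt (τ K - τ 0 + 1) (hne r hr hr1 a ha)] with η h _ using h
    · simp [hr1]
  obtain ⟨η, ⟨hηT, hηR⟩, hη0⟩ := (hη.and self_mem_nhdsWithin).exists
  rw [mul_one] at hηT
  replace hη0 : 0 < η := hη0
  have hgap : ∀ a ∈ Finset.range K, 0 < (τ (a + 1) - τ a) / 2 := fun a ha =>
    half_pos (sub_pos.2 (hτ a (Finset.mem_range.1 ha)))
  have hε : ∀ᶠ ε : ℝ in 𝓝[>] 0, ε * 1 < 1 ∧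
      (∀ a ∈ Finset.range K, ε * 1 < (τ (a + 1) - τ a) / 2) ∧
      (∀ r ∈ R, 0 < r 1 → ∀ a ∈ Finset.range (K + 1), ε * r 1 < |r 0 - τ a * r 1| / 2) ∧
      ∀ b ∈ B, ∀ a ∈ Finset.range K, ε * (2 * b 1) < η * ((τ (a + 1) - τ a) / 2) := by
    refine (eventually_mul_lt 1 one_pos).and (((Finset.eventually_all _).2 fun a ha =>
      eventually_mul_lt 1 (hgap a ha)).and (((Finset.eventually_all _).2 fun r hr => ?_).and
      ((Finset.eventually_all _).2 fun b hb => (Finset.eventually_all _).2 fun a ha =>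
      eventually_mul_lt _ (mul_pos hη0 (hgap a ha)))))
    by_cases hr1 : 0 < r 1
    · filter_upwards [(Finset.eventually_all _).2 fun a ha =>
        eventually_mul_lt (r 1) (hne r hr hr1 a ha)] with ε h _ using h
    · simp [hr1]
  obtain ⟨ε, ⟨hε1, hετ, hεR, hεB⟩, hε0⟩ := (hε.and self_mem_nhdsWithin).exists
  replace hε0 : 0 < ε := hε0
  simp only [mul_one, Finset.mem_range] at hε1 hετ hεB hηR hεR
  obtain ⟨F, hN, hFβ, hσ, htip, hcorner, hwall⟩ :=
    Fan.exists_comb hK hβ hε0 hετ hη0 hηT (B ∪ R)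
  have hσN : F.σ F.N = τ K := by rw [hN, hσ, combσ_even]; simp
  have heven : ∀ a < K, F.σ (2 * a) = τ a - ε := fun a ha => by
    rw [hσ, combσ_even, if_neg ha.ne]
  have hodd : ∀ a, F.σ (2 * a + 1) = (τ a + τ (a + 1)) / 2 := fun a => by rw [hσ, combσ_odd]
  have h0 : F.σ 0 = τ 0 - ε := by simpa using heven 0 hK
  refine ⟨F, hN, hσN, hFβ, F.numConvex_le hN hηT htip hcorner, fun b hb => ?_, fun r hr => ?_⟩
  · obtain ⟨hl, hr⟩ := hwall b (Finset.mem_union_left _ hb)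
    obtain ⟨hb1, a, ha, hba⟩ := hB b hb
    have hab := hτ a ha
    have m0 : τ 0 ≤ τ a := fan_mono hτ (Nat.zero_le a) ha.le
    have m1 : τ a < τ K := fan_strictMono hτ ha le_rfl
    refine F.notMem_region_of_gauge hl hr hb1 ?_ ?_ ?_
    · rw [h0, hba]; gcongr; linarith
    · rw [hσN, hba]; gcongr
    · refine F.gauge_lt_of_tip (i := 2 * a) (by omega) hb1 ?_ ?_ ?_ ?_
      · rw [htip a ha]; exact hT b hb
      · rw [heven a ha, hba]; gcongr; linarith
      · rw [hodd, hba]; gcongr; linarith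
      · rw [heven a ha, hodd, hcorner a ha, hba]
        have := mul_le_mul_of_nonneg_right (hεB b hb a ha).le hb1.le
        linarith
  · obtain ⟨hl, hr'⟩ := hwall r (Finset.mem_union_right _ hr)
    refine F.mem_interior_of_core ⟨hl, hr', ?_⟩
    rcases hR r hr with h | ⟨hr1, hrK, -⟩
    · exact Or.inr (Or.inr (Or.inl h))
    rcases lt_or_ge (r 0) (τ 0 * r 1) with h | h
    · left
      have := hεR r hr hr1 0 (by omega)
      rw [abs_of_neg (by linarith)] at this
      rw [h0]
      linarith
    · right; right; right
      refine ⟨hr1, by rwa [hσN], ?_⟩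
      obtain ⟨a, ha, hra, hra'⟩ := exists_sector hK h hrK.le
      have hab := hτ a ha
      have e1 := hηR r hr hr1 a (by omega)
      have e2 := hηR r hr hr1 (a + 1) (by omega)
      have e3 := hεR r hr hr1 (a + 1) (by omega)
      rw [abs_of_nonneg (by linarith)] at e1
      rw [abs_of_nonpos (by linarith)] at e2 e3
      have m0 : τ 0 ≤ τ a := fan_mono hτ (Nat.zero_le a) ha.le
      have m1 : τ (a + 1) ≤ τ K := fan_mono hτ ha le_rfl
      have hεr : 0 < ε * r 1 := mul_pos hε0 hr1
      rcases le_total (r 0) ((τ a + τ (a + 1)) / 2 * r 1) with hm | hm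
      · refine F.one_lt_gauge_of_left (i := 2 * a) (by omega) hr1 ?_ ?_ ?_
        · rw [heven a ha]; linarith
        · rw [hodd]; exact hm
        · rw [heven a ha, hodd, hcorner a ha]
          have : η * ((τ a + τ (a + 1)) / 2 - (τ a - ε)) ≤ η * (τ K - τ 0 + 1) := by
            gcongr; linarith
          linarith
      · have hs : 2 * a + 1 + 1 = 2 * (a + 1) := by ring
        obtain ⟨e, he0, he, hσe⟩ : ∃ e, 0 ≤ e ∧ e ≤ ε ∧ F.σ (2 * a + 1 + 1) = τ (a + 1) - e := by
          rw [hs, hσ, combσ_even]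
          split_ifs
          · exact ⟨0, le_rfl, hε0.le, rfl⟩
          · exact ⟨ε, hε0.le, le_rfl, rfl⟩
        have her : e * r 1 ≤ ε * r 1 := by gcongr
        refine F.one_lt_gauge_of_right (i := 2 * a + 1) (by omega) hr1 ?_ ?_ ?_
        · rw [hodd]; exact hm
        · rw [hσe]; linarith
        · rw [hσe, hodd, hcorner a ha]
          have : η * (τ (a + 1) - e - (τ a + τ (a + 1)) / 2) ≤ η * (τ K - τ 0 + 1) := by
            gcongr; linarith
          linarith

/-- The inverse slope of the vector `p`. -/
def cot (p : Pt) : ℝ := p 0 / p 1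

lemma exists_lt_forall_lt (S : Finset ℝ) {M : ℝ} (h : ∀ x ∈ S, x < M) :
    ∃ t < M, ∀ x ∈ S, x < t := by
  rcases S.eq_empty_or_nonempty with rfl | hS
  · exact ⟨M - 1, by linarith, by simp⟩
  · obtain ⟨t, h1, h2⟩ := exists_between (h _ (S.max'_mem hS))
    exact ⟨t, h2, fun x hx => (S.le_max' x hx).trans_lt h1⟩

lemma exists_increasing_enum (S : Finset ℝ) {t : ℝ} (h : ∀ x ∈ S, x < t) :
    ∃ τ : ℕ → ℝ, (∀ a < S.card, τ a < τ (a + 1)) ∧ τ S.card = t ∧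
      (∀ x ∈ S, ∃ a < S.card, τ a = x) ∧ ∀ a < S.card, τ a ∈ S := by
  refine ⟨fun a => if ha : a < S.card then S.orderEmbOfFin rfl ⟨a, ha⟩ else t,
    fun a ha => ?_, by simp, fun x hx => ?_, fun a ha => ?_⟩
  · simp only [ha, dite_true]
    split_ifs
    · simp
    · exact h _ (S.orderEmbOfFin_mem rfl _)
  · have : x ∈ Set.range (S.orderEmbOfFin rfl) := by simpa using hx
    obtain ⟨i, rfl⟩ := this
    exact ⟨i, i.2, by simp⟩
  · simp only [ha, dite_true]
    exact S.orderEmbOfFin_mem rfl _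

lemma SeparableWithin.of_cot {B C R : Finset Pt} {b₁ b₂ : Pt} (hC : C.Nonempty)
    (hBC : ∀ b ∈ B, b = b₁ ∨ b = b₂ ∨ b ∈ C) (h₁ : 0 < b₁ 1) (h₂ : 0 < b₂ 1)
    (hpos : ∀ b ∈ C, 0 < b 1 ∧ cot b < cot b₁ ∧ cot b < cot b₂)
    (hR : ∀ r ∈ R, r 1 < 0 ∨ (0 < r 1 ∧ cot r < cot b₁ ∧ cot r < cot b₂ ∧
      ∀ b ∈ C, cot r ≠ cot b))
    {m : ℕ} (hm : (C.image cot).card + 3 ≤ m) : SeparableWithin m (B : Set Pt) R := by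
  obtain ⟨t, htM, ht⟩ := exists_lt_forall_lt ((C ∪ R.filter fun r => 0 < r 1).image cot)
    (M := min (cot b₁) (cot b₂)) fun x hx => by
      obtain ⟨p, hp, rfl⟩ := Finset.mem_image.1 hx
      rcases Finset.mem_union.1 hp with hp | hp
      · exact lt_min (hpos p hp).2.1 (hpos p hp).2.2
      · obtain ⟨hp, hp1⟩ := Finset.mem_filter.1 hp
        rcases hR p hp with h | h
        · linarith
        · exact lt_min h.2.1 h.2.2.1
  obtain ⟨τ, hτ, hτK, hτC, hτmem⟩ := exists_increasing_enum (C.image cot) (t := t) fun x hx =>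
    ht x (Finset.image_subset_image Finset.subset_union_left hx)
  have hK : 1 ≤ (C.image cot).card := Finset.card_pos.2 (hC.image _)
  obtain ⟨ht₁, ht₂⟩ := lt_min_iff.1 htM
  set K := (C.image cot).card
  have hβ : τ K < max (cot b₁) (cot b₂) + 1 := by
    have := le_max_left (cot b₁) (cot b₂)
    linarith
  obtain ⟨F, hN, hσN, hFβ, hconv, hFB, hFR⟩ := Fan.exists_separating hK hτ hβ (B := C) (R := R)
    (fun b hb => by
      obtain ⟨a, ha, hab⟩ := hτC _ (Finset.mem_image_of_mem _ hb)
      refine ⟨(hpos b hb).1, a, ha, ?_⟩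
      rw [hab, cot, div_mul_cancel₀ _ (hpos b hb).1.ne'])
    (fun r hr => by
      refine (hR r hr).imp_right fun ⟨h0, _, _, h3⟩ => ⟨h0, ?_, fun a ha h => ?_⟩
      · rw [← div_lt_iff₀ h0, hτK]
        exact ht _ (Finset.mem_image_of_mem _ (Finset.mem_union_right _
          (Finset.mem_filter.2 ⟨hr, h0⟩)))
      · obtain ⟨b, hb, hba⟩ := Finset.mem_image.1 (hτmem a ha)
        exact h3 b hb (by rw [hba, cot, h, mul_div_cancel_right₀ _ h0.ne']))
  have hwedge : ∀ b : Pt, 0 < b 1 → t < cot b → cot b ≤ max (cot b₁) (cot b₂) →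
      b ∉ F.polygon.region := fun b hb h1 h2 => by
    refine F.notMem_region_of_wedge ⟨hb, ?_, ?_⟩
    · rw [hσN, hτK, ← lt_div_iff₀ hb]
      exact h1
    · rw [hFβ, ← div_lt_iff₀ hb]
      exact h2.trans_lt (lt_add_one _)
  refine ⟨F.polygon, F.polygon_ccw, hconv.trans hm, ?_, hFR, fun b hb => ?_⟩
  · change F.N + 4 ≤ _
    omega
  · rcases hBC b hb with rfl | rfl | hb
    · exact hwedge _ h₁ ht₁ (le_max_left _ _)
    · exact hwedge _ h₂ ht₂ (le_max_right _ _)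
    · exact hFB b hb

/-- The linear automorphism of the plane with coordinate functions `det2 f` and `det2 g`. -/
def coordEquiv (f g : Pt) (h : det2 f g ≠ 0) : Pt ≃ₗ[ℝ] Pt where
  toFun w := mkPt (det2 f w) (det2 g w)
  invFun q := (det2 f g)⁻¹ • (q 0 • g - q 1 • f)
  map_add' u v := by ext i; fin_cases i <;> simp [det2] <;> ring
  map_smul' t v := by ext i; fin_cases i <;> simp [det2] <;> ring
  left_inv w := by
    rw [inv_smul_eq_iff₀ h]
    ext i
    fin_cases i <;> simp [det2] <;> ring
  right_inv q := by
    have e1 : det2 f ((det2 f g)⁻¹ • (q 0 • g - q 1 • f)) = q 0 := by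
      refine Eq.trans ?_ (inv_mul_cancel_left₀ h (q 0))
      simp only [det2, PiLp.smul_apply, PiLp.sub_apply, smul_eq_mul]
      ring
    have e2 : det2 g ((det2 f g)⁻¹ • (q 0 • g - q 1 • f)) = q 1 := by
      refine Eq.trans ?_ (inv_mul_cancel_left₀ h (q 1))
      simp only [det2, PiLp.smul_apply, PiLp.sub_apply, smul_eq_mul]
      ring
    ext i
    fin_cases i
    · exact (mkPt_zero _ _).trans e1
    · exact (mkPt_one _ _).trans e2

lemma det2_coordEquiv_symm (f g : Pt) (h : det2 f g ≠ 0) (u v : Pt) :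
    det2 ((coordEquiv f g h).symm u) ((coordEquiv f g h).symm v) = (det2 f g)⁻¹ * det2 u v := by
  change det2 ((det2 f g)⁻¹ • (u 0 • g - u 1 • f)) ((det2 f g)⁻¹ • (v 0 • g - v 1 • f)) = _
  have h' : f 0 * g 1 - f 1 * g 0 ≠ 0 := h
  simp only [det2, PiLp.smul_apply, PiLp.sub_apply, smul_eq_mul]
  field_simp
  ring

lemma SeparableWithin.of_coord {m : ℕ} {B R : Set Pt} {f g : Pt} (hfg : det2 f g ≠ 0) (o : Pt)
    (h : SeparableWithin m ((fun w => coordEquiv f g hfg w + o) '' B)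
      ((fun w => coordEquiv f g hfg w + o) '' R)) : SeparableWithin m B R := by
  have h := h.of_image ((AffineEquiv.constVAdd ℝ Pt (-o)).trans
    (coordEquiv f g hfg).symm.toAffineEquiv) _ (inv_ne_zero hfg)
    (det2_coordEquiv_symm f g hfg)
  simpa [Set.image_image] using h

open Filter Topology in
lemma eventually_affine_ne_zero {a c : ℝ} (h : a ≠ 0 ∨ c ≠ 0) :
    ∀ᶠ t : ℝ in 𝓝[>] 0, t * a + c ≠ 0 := by
  by_cases hc : c = 0
  · subst hc
    filter_upwards [self_mem_nhdsWithin] with t ht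
    simpa using ⟨(ne_of_gt ht : t ≠ 0), h.resolve_right (by simp)⟩
  · have : Continuous fun t : ℝ => t * a + c := by fun_prop
    refine (this.tendsto 0).mono_left nhdsWithin_le_nhds |>.eventually_ne ?_
    simpa using hc

open Filter Topology in
lemma SeparableWithin.of_coord_signs {B C R : Finset Pt} {b₁ b₂ p q : Pt} {f g : Pt}
    (hfg : det2 f g ≠ 0) {x y : ℝ}
    (hBC : ∀ b ∈ B, b = b₁ ∨ b = b₂ ∨ b ∈ C)
    (hx₁ : 0 < det2 f b₁ + x) (hx₂ : 0 < det2 f b₂ + x)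
    (hy₁ : det2 g b₁ + y = 0) (hy₂ : det2 g b₂ + y = 0)
    (hp : p ∈ C) (hq : q ∈ C) (hpq : p ≠ q)
    (hxp : det2 f p + x = 0) (hxq : det2 f q + x = 0)
    (hC : ∀ s ∈ C, 0 < det2 g s + y)
    (hR : ∀ r ∈ R, det2 f r + x ≠ 0 ∧ det2 g r + y ≠ 0) (hCR : Disjoint C R)
    {m : ℕ} (hm : C.card + 2 ≤ m) : SeparableWithin m (B : Set Pt) R := by
  have hinj : ∀ r ∈ R, ∀ s ∈ C, det2 f r = det2 f s → det2 g r ≠ det2 g s := by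
    intro r hr s hs h1 h2
    refine Finset.disjoint_left.1 hCR hs ?_
    rwa [← (coordEquiv f g hfg).injective
      (show coordEquiv f g hfg r = coordEquiv f g hfg s from congrArg₂ mkPt h1 h2)]
  have hδ : ∀ᶠ δ : ℝ in 𝓝[>] 0,
      (∀ r ∈ R, det2 g r + y < 0 → δ * 1 < -(det2 g r + y)) ∧
      (∀ w ∈ C ∪ R, 0 < det2 g w + y →
        δ * (det2 f w - det2 f b₁) < (det2 f b₁ + x) * (det2 g w + y) ∧
        δ * (det2 f w - det2 f b₂) < (det2 f b₂ + x) * (det2 g w + y)) ∧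
      ∀ r ∈ R, ∀ s ∈ C, δ * (det2 f r - det2 f s) +
        ((det2 f r + x) * (det2 g s + y) - (det2 f s + x) * (det2 g r + y)) ≠ 0 := by
    refine ((Finset.eventually_all _).2 fun r _ => ?_).and
      (((Finset.eventually_all _).2 fun w _ => ?_).and ((Finset.eventually_all _).2 fun r hr =>
        (Finset.eventually_all _).2 fun s hs => eventually_affine_ne_zero ?_))
    · by_cases h : det2 g r + y < 0
      · filter_upwards [eventually_mul_lt 1 (neg_pos.2 h)] with δ hδ _ using hδ
      · simp [h]
    · by_cases h : 0 < det2 g w + y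
      · filter_upwards [eventually_mul_lt (det2 f w - det2 f b₁) (mul_pos hx₁ h),
          eventually_mul_lt (det2 f w - det2 f b₂) (mul_pos hx₂ h)] with δ h1 h2 _ using ⟨h1, h2⟩
      · simp [h]
    · by_cases h : det2 f r = det2 f s
      · right
        rw [← h, ← mul_sub]
        refine mul_ne_zero (hR r hr).1 (sub_ne_zero.2 fun h' => hinj r hr s hs h ?_)
        linarith
      · exact Or.inl (sub_ne_zero.2 h)
  obtain ⟨δ, ⟨hδR, hδb, hδne⟩, hδ0⟩ := (hδ.and self_mem_nhdsWithin).exists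
  replace hδ0 : 0 < δ := hδ0
  refine SeparableWithin.of_coord hfg (mkPt x (y + δ)) ?_
  set A : Pt → Pt := fun w => coordEquiv f g hfg w + mkPt x (y + δ) with hA
  have hA0 : ∀ w, A w 0 = det2 f w + x := fun w => by
    change (mkPt (det2 f w) (det2 g w) + mkPt x (y + δ)) 0 = _
    simp
  have hA1 : ∀ w, A w 1 = det2 g w + y + δ := fun w => by
    change (mkPt (det2 f w) (det2 g w) + mkPt x (y + δ)) 1 = _
    simp [add_assoc]
  have hcot : ∀ w ∈ C ∪ R, 0 < det2 g w + y → cot (A w) < cot (A b₁) ∧ cot (A w) < cot (A b₂) := by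
    intro w hw hw0
    obtain ⟨h1, h2⟩ := hδb w hw hw0
    simp only [cot, hA0, hA1, hy₁, hy₂, zero_add]
    rw [div_lt_div_iff₀ (by linarith) hδ0, div_lt_div_iff₀ (by linarith) hδ0]
    constructor <;> linarith
  have hcard : ((C.image A).image cot).card < C.card := by
    rw [Finset.image_image]
    refine Finset.card_image_le.lt_of_ne fun h => hpq (Finset.card_image_iff.1 h hp hq ?_)
    simp [cot, hA0, hxp, hxq]
  rw [← Finset.coe_image, ← Finset.coe_image]
  refine SeparableWithin.of_cot (C := C.image A) (b₁ := A b₁) (b₂ := A b₂)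
    ⟨A p, Finset.mem_image_of_mem _ hp⟩ ?_ ?_ ?_ ?_ ?_ (by omega)
  · intro b hb
    obtain ⟨b, hb', rfl⟩ := Finset.mem_image.1 hb
    rcases hBC b hb' with rfl | rfl | h
    · exact Or.inl rfl
    · exact Or.inr (Or.inl rfl)
    · exact Or.inr (Or.inr (Finset.mem_image_of_mem _ h))
  · rw [hA1, hy₁]; simpa
  · rw [hA1, hy₂]; simpa
  · intro b hb
    obtain ⟨s, hs, rfl⟩ := Finset.mem_image.1 hb
    refine ⟨?_, hcot s (Finset.mem_union_left _ hs) (hC s hs)⟩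
    rw [hA1]
    linarith [hC s hs]
  · intro r hr
    obtain ⟨r, hr', rfl⟩ := Finset.mem_image.1 hr
    rcases lt_or_gt_of_ne (hR r hr').2 with h | h
    · left
      rw [hA1]
      linarith [hδR r hr' h]
    · right
      have hpos : 0 < A r 1 := by rw [hA1]; linarith
      obtain ⟨h1, h2⟩ := hcot r (Finset.mem_union_right _ hr') h
      refine ⟨hpos, h1, h2, fun b hb heq => ?_⟩
      obtain ⟨s, hs, rfl⟩ := Finset.mem_image.1 hb
      have hs0 := hC s hs
      simp only [cot, hA0, hA1] at heq
      rw [div_eq_div_iff (by linarith) (by linarith)] at heq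
      exact hδne r hr' s hs (by linarith)

lemma separableWithin_card (B R : Finset Pt) (hdisj : Disjoint B R)
    (hgp : StrongGenPos (↑B ∪ ↑R : Set Pt)) (hcard : 5 ≤ B.card) :
    SeparableWithin B.card (B : Set Pt) R := by
  have hmB : ∀ {w}, w ∈ B → w ∈ (↑B ∪ ↑R : Set Pt) := fun h => Or.inl h
  have hmR : ∀ {w}, w ∈ R → w ∈ (↑B ∪ ↑R : Set Pt) := fun h => Or.inr h
  obtain ⟨b, hb, c, hc, p, hp, q, hq, hbc, hpq, hpb, hpc, hqb, hqc, hpos, hside⟩ :=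
    exists_hull_edge_and_line B hcard fun u hu v hv w hw =>
      hgp.1 u (hmB hu) v (hmB hv) w (hmB hw)
  have hRne : ∀ u ∈ B, ∀ v ∈ B, u ≠ v → ∀ r ∈ R, orient u v r ≠ 0 := fun u hu v hv huv r hr =>
    hgp.1 u (hmB hu) v (hmB hv) r (hmR hr) huv (Finset.disjoint_iff_ne.1 hdisj u hu r hr)
      (Finset.disjoint_iff_ne.1 hdisj v hv r hr)
  obtain ⟨μ, hμ, h1, h2⟩ : ∃ μ : ℝ, μ ≠ 0 ∧ 0 < μ * orient p q b ∧ 0 < μ * orient p q c := by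
    refine ⟨orient p q b, fun h => ?_, mul_self_pos.2 fun h => ?_, hside⟩ <;>
      · rw [h, zero_mul] at hside
        exact hside.false
  have hX : ∀ w, det2 (μ • (q - p)) w + -det2 (μ • (q - p)) p = μ * orient p q w := fun w => by
    simp only [orient, det2, PiLp.smul_apply, PiLp.sub_apply, smul_eq_mul]
    ring
  have hY : ∀ w, det2 (c - b) w + -det2 (c - b) b = orient b c w := fun w => by
    simp only [orient, det2, PiLp.sub_apply]
    ring
  have hdet : det2 (μ • (q - p)) (c - b) ≠ 0 := by
    have : det2 (μ • (q - p)) (c - b) = μ * det2 (q - p) (c - b) := by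
      simp only [det2, PiLp.smul_apply, smul_eq_mul]
      ring
    rw [this]
    exact mul_ne_zero hμ (hgp.2 p (hmB hp) q (hmB hq) b (hmB hb) c (hmB hc)
      hpq hpb hpc hqb hqc hbc)
  have hmem : ∀ {s}, s ∈ (B.erase b).erase c ↔ s ≠ c ∧ s ≠ b ∧ s ∈ B := by simp
  refine SeparableWithin.of_coord_signs (C := (B.erase b).erase c) (b₁ := b) (b₂ := c)
    (p := p) (q := q) hdet (x := -det2 (μ • (q - p)) p) (y := -det2 (c - b) b)
    (fun s hs => ?_) ?_ ?_ ?_ ?_ (hmem.2 ⟨hpc, hpb, hp⟩) (hmem.2 ⟨hqc, hqb, hq⟩) hpq ?_ ?_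
    (fun s hs => ?_) (fun r hr => ?_) ?_ ?_
  · rw [hmem]; tauto
  · rwa [hX]
  · rwa [hX]
  · rw [hY, orient_def]; ring
  · rw [hY, orient_def]; ring
  · rw [hX, orient_def]; ring
  · rw [hX, orient_def]; ring
  · obtain ⟨h1, h2, h3⟩ := hmem.1 hs
    rw [hY]
    exact hpos s h3 h2 h1
  · rw [hX, hY]
    exact ⟨mul_ne_zero hμ (hRne p hp q hq hpq r hr), hRne b hb c hc hbc r hr⟩
  · exact hdisj.mono_left ((Finset.erase_subset _ _).trans (Finset.erase_subset _ _))
  · rw [Finset.card_erase_of_mem (Finset.mem_erase.2 ⟨hbc.symm, hc⟩), Finset.card_erase_of_mem hb]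
    omega

/-- Any set `B` of at least five points is separable from any disjoint set `R`,
by a simple polygon with at most `2|B| − 2` vertices. -/
theorem five_or_more_separable
    (B R : Finset Pt) (hdisj : Disjoint B R)
    (hgp : StrongGenPos ((↑B ∪ ↑R : Set Pt)))
    (hcard : 5 ≤ B.card) :
    ∃ P : SimplePolygon, P.CCW ∧ P.numConvex ≤ B.card ∧ P.n ≤ 2 * B.card - 2 ∧
      (∀ r ∈ R, r ∈ P.interior) ∧ ∀ b ∈ B, b ∉ P.region :=
  separableWithin_card B R hdisj hgp hcard
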